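/- arXiv:2310.04807 — 4 statements merged into one kernel-verified Lean document; each statement's English description precedes it below -/
import Mathlib

section
/- (Lemma 4.8, 1D case, d = 1.) Let u_h ∈ V^k, let U be a C^{k+1} periodic function on Ω, and set ξ = u_h − P*U. Assume the partition is quasi-uniform, ‖u_h − avg(u_h)‖_{L∞(Ω)} ≥ c₀ > 0, the cell wave speeds satisfy 0 ≤ β_j ≤ β_max, and ‖ξ‖_{L∞(Ω)} ≤ h ≤ 1. Then there is a constant C, depending only on k, c₀, β_max, γ, and the C^{k+1} norm of U, such that ‖F_τ u_h − u_h‖_{L²(Ω)} ≤ C τ ( ‖ξ‖_{L²(Ω)} + h^{k+1} ). -/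
open Polynomial Finset MeasureTheory

namespace OEDG

variable {N : ℕ}

/-- `pt` lists the nodes `x_{1/2} < x_{3/2} < … < x_{N+1/2}` of a partition of `Ω = [0,1]`. -/
def IsMesh (pt : Fin (N+1) → ℝ) : Prop :=
  pt 0 = 0 ∧ pt (Fin.last N) = 1 ∧ StrictMono pt

/-- Left endpoint of cell `j`. -/
def ptL (pt : Fin (N+1) → ℝ) (j : Fin N) : ℝ := pt j.castSucc

/-- Right endpoint of cell `j`. -/
def ptR (pt : Fin (N+1) → ℝ) (j : Fin N) : ℝ := pt j.succ

/-- Length `h_j` of cell `j`. -/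
def cellh (pt : Fin (N+1) → ℝ) (j : Fin N) : ℝ := ptR pt j - ptL pt j

/-- Maximal mesh size `h`. -/
noncomputable def meshSize (pt : Fin (N+1) → ℝ) : ℝ := ⨆ j : Fin N, cellh pt j

/-- Quasi-uniformity of the partition: `h ≤ γ h_j` for all `j`. -/
def QuasiUniform (pt : Fin (N+1) → ℝ) (γ : ℝ) : Prop :=
  ∀ j : Fin N, meshSize pt ≤ γ * cellh pt j

/-- Membership in `V^k`: every cell polynomial has degree at most `k`. -/
def MemVk (k : ℕ) (u : Fin N → Polynomial ℝ) : Prop :=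
  ∀ j, (u j).natDegree ≤ k

/-- Cellwise `L²` inner product. -/
noncomputable def cip (pt : Fin (N+1) → ℝ) (j : Fin N) (p q : Polynomial ℝ) : ℝ :=
  ∫ x in (ptL pt j)..(ptR pt j), p.eval x * q.eval x

/-- Global `L²(Ω)` inner product of piecewise polynomials. -/
noncomputable def ip (pt : Fin (N+1) → ℝ) (u v : Fin N → Polynomial ℝ) : ℝ :=
  ∑ j : Fin N, cip pt j (u j) (v j)

/-- Cellwise `L²` norm. -/
noncomputable def cl2 (pt : Fin (N+1) → ℝ) (j : Fin N) (p : Polynomial ℝ) : ℝ :=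
  Real.sqrt (cip pt j p p)

/-- Global `L²(Ω)` norm of a piecewise polynomial. -/
noncomputable def l2 (pt : Fin (N+1) → ℝ) (u : Fin N → Polynomial ℝ) : ℝ :=
  Real.sqrt (ip pt u u)

/-- Average `avg(u) = (1/|Ω|) ∫_Ω u dx` (here `|Ω| = 1`). -/
noncomputable def avg (pt : Fin (N+1) → ℝ) (u : Fin N → Polynomial ℝ) : ℝ :=
  ∑ j : Fin N, ∫ x in (ptL pt j)..(ptR pt j), (u j).eval x

/-- `‖u - c‖_{L∞(Ω)}` for a piecewise polynomial `u` and a constant `c`. -/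
noncomputable def linfSub (pt : Fin (N+1) → ℝ) (u : Fin N → Polynomial ℝ) (c : ℝ) : ℝ :=
  ⨆ j : Fin N, sSup ((fun x => |(u j).eval x - c|) '' Set.Icc (ptL pt j) (ptR pt j))

/-- `m`-th derivative of a polynomial. -/
noncomputable def pderiv (m : ℕ) (p : Polynomial ℝ) : Polynomial ℝ :=
  (fun q : Polynomial ℝ => Polynomial.derivative q)^[m] p

/-- Jump `[∂_x^m u]_{j+1/2}` of the `m`-th derivative at the interface to the right of
cell `j`, with periodic identification of `x_{N+1/2}` with `x_{1/2}`. -/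
noncomputable def jumpD [NeZero N] (pt : Fin (N+1) → ℝ) (u : Fin N → Polynomial ℝ)
    (m : ℕ) (j : Fin N) : ℝ :=
  (pderiv m (u (j+1))).eval (pt (Fin.castSucc (j+1))) - (pderiv m (u j)).eval (pt j.succ)

/-- The scale-invariant damping coefficient `σ_j^m(u)` of the OEDG method. -/
noncomputable def sigma [NeZero N] (k : ℕ) (pt : Fin (N+1) → ℝ)
    (u : Fin N → Polynomial ℝ) (m : ℕ) (j : Fin N) : ℝ :=
  if ∀ i, u i = Polynomial.C (avg pt u) then 0
  else (2*(m:ℝ)+1) * (cellh pt j)^m / ((2*(k:ℝ)-1) * (Nat.factorial m)) *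
    ((|jumpD pt u m (j-1)| + |jumpD pt u m j|) / (2 * linfSub pt u (avg pt u)))

/-- Damping rate `δ_j^m = β_j σ_j^m(u) / h_j`. -/
noncomputable def dampRate [NeZero N] (k : ℕ) (pt : Fin (N+1) → ℝ) (β : Fin N → ℝ)
    (u : Fin N → Polynomial ℝ) (m : ℕ) (j : Fin N) : ℝ :=
  β j * sigma k pt u m j / cellh pt j

/-- `Pc j d` is the cellwise `L²(I_j)`-orthogonal projection onto `ℙ^d(I_j)`.
(The family `Pc` realizes the global projections `P^d` onto `V^d`.) -/
def IsCellProj (pt : Fin (N+1) → ℝ)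
    (Pc : Fin N → ℕ → Polynomial ℝ → Polynomial ℝ) : Prop :=
  ∀ (j : Fin N) (dd : ℕ) (p : Polynomial ℝ), (Pc j dd p).natDegree ≤ dd ∧
    ∀ q : Polynomial ℝ, q.natDegree ≤ dd → cip pt j (p - Pc j dd p) q = 0

/-- `w` solves the damping initial value problem with initial data `u`:
`d/dt̂ ∫_{I_j} u_σ v dx + ∑_{m=0}^k (β_j σ_j^m(u)/h_j) ∫_{I_j} (u_σ - P^{m-1} u_σ) v dx = 0`
for every `v ∈ ℙ^k(I_j)` and every `j`, with `u_σ(·,0) = u`.  (Note `m - 1` is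
truncated ℕ-subtraction, which realizes the convention `P^{-1} = P^0`.) -/
def IsDampingSol [NeZero N] (k : ℕ) (pt : Fin (N+1) → ℝ) (β : Fin N → ℝ)
    (Pc : Fin N → ℕ → Polynomial ℝ → Polynomial ℝ)
    (u : Fin N → Polynomial ℝ) (w : ℝ → Fin N → Polynomial ℝ) : Prop :=
  w 0 = u ∧ (∀ t j, (w t j).natDegree ≤ k) ∧
  ∀ (t : ℝ) (j : Fin N) (v : Polynomial ℝ), v.natDegree ≤ k →
    HasDerivAt (fun s => cip pt j (w s j) v)
      (-(∑ m ∈ Finset.range (k+1),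
        dampRate k pt β u m j * cip pt j (w t j - Pc j (m-1) (w t j)) v)) t

/-- `Fτ` is the OE (oscillation-eliminating) operator: for every `u ∈ V^k` the damping
initial value problem has a solution `w` and `Fτ u = w τ`. -/
def IsOEOp [NeZero N] (k : ℕ) (pt : Fin (N+1) → ℝ) (β : Fin N → ℝ)
    (Pc : Fin N → ℕ → Polynomial ℝ → Polynomial ℝ) (τ : ℝ)
    (Fτ : (Fin N → Polynomial ℝ) → (Fin N → Polynomial ℝ)) : Prop :=
  ∀ u, MemVk k u → ∃ w, IsDampingSol k pt β Pc u w ∧ Fτ u = w τ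

/-- Right-hand side of the weak form of the upwind DG operator for `u_t + β u_x = 0`:
`β ∫_{I_j} w v_x dx - β w(x_{j+1/2}^-) v(x_{j+1/2}^-) + β w(x_{j-1/2}^-) v(x_{j-1/2}^+)`. -/
noncomputable def dgRHS [NeZero N] (pt : Fin (N+1) → ℝ) (β : ℝ)
    (w : Fin N → Polynomial ℝ) (j : Fin N) (v : Polynomial ℝ) : ℝ :=
  β * (∫ x in (ptL pt j)..(ptR pt j), (w j).eval x * (Polynomial.derivative v).eval x)
  - β * (w j).eval (ptR pt j) * v.eval (ptR pt j)
  + β * (w (j-1)).eval (pt (j-1).succ) * v.eval (ptL pt j)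

/-- `L` is the upwind DG spatial operator on `V^k`. -/
def IsDGOp [NeZero N] (k : ℕ) (pt : Fin (N+1) → ℝ) (β : ℝ)
    (L : (Fin N → Polynomial ℝ) → (Fin N → Polynomial ℝ)) : Prop :=
  ∀ w, MemVk k w → MemVk k (L w) ∧
    ∀ (j : Fin N) (v : Polynomial ℝ), v.natDegree ≤ k →
      cip pt j (L w j) v = dgRHS pt β w j v

/-- The upwind DG bilinear form
`H(w,v) = β ∑_j ∫_{I_j} w v_x dx + β ∑_j w(x_{j+1/2}^-) [v]_{j+1/2}`. -/
noncomputable def Hform [NeZero N] (pt : Fin (N+1) → ℝ) (β : ℝ)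
    (w v : Fin N → Polynomial ℝ) : ℝ :=
  β * ∑ j : Fin N, (∫ x in (ptL pt j)..(ptR pt j),
      (w j).eval x * (Polynomial.derivative (v j)).eval x)
  + β * ∑ j : Fin N, (w j).eval (ptR pt j) * jumpD pt v 0 j

/-- The upwind DG bilinear form with piecewise-smooth first argument. -/
noncomputable def HformF [NeZero N] (pt : Fin (N+1) → ℝ) (β : ℝ)
    (w : Fin N → ℝ → ℝ) (v : Fin N → Polynomial ℝ) : ℝ :=
  β * ∑ j : Fin N, (∫ x in (ptL pt j)..(ptR pt j),
      w j x * (Polynomial.derivative (v j)).eval x)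
  + β * ∑ j : Fin N, w j (ptR pt j) * jumpD pt v 0 j

/-- `L²(Ω)` pairing of a piecewise-smooth function with a piecewise polynomial. -/
noncomputable def ipF (pt : Fin (N+1) → ℝ) (w : Fin N → ℝ → ℝ)
    (v : Fin N → Polynomial ℝ) : ℝ :=
  ∑ j : Fin N, ∫ x in (ptL pt j)..(ptR pt j), w j x * (v j).eval x

/-- One Runge–Kutta stage: `∑_{0≤m≤ℓ} (c_{ℓm} u_σ^{n,m} + τ d_{ℓm} L(u_σ^{n,m}))`. -/
noncomputable def rkStage [NeZero N] (c d : ℕ → ℕ → ℝ) (τ : ℝ)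
    (L : (Fin N → Polynomial ℝ) → (Fin N → Polynomial ℝ))
    (uσ : ℕ → Fin N → Polynomial ℝ) (ℓ : ℕ) : Fin N → Polynomial ℝ :=
  fun j => ∑ m ∈ Finset.range (ℓ+1),
    (Polynomial.C (c ℓ m) * uσ m j + Polynomial.C (τ * d ℓ m) * L (uσ m) j)

/-- One full OEDG time step from `u_σ^n = un`: the stages `u_h^{n,ℓ+1}` and
`u_σ^{n,ℓ+1} = F_τ u_h^{n,ℓ+1}`, `0 ≤ ℓ ≤ s-1`. -/
def IsOEDGStep [NeZero N] (s : ℕ) (c d : ℕ → ℕ → ℝ) (τ : ℝ)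
    (L Fτ : (Fin N → Polynomial ℝ) → (Fin N → Polynomial ℝ))
    (un : Fin N → Polynomial ℝ) (uh uσ : ℕ → Fin N → Polynomial ℝ) : Prop :=
  uσ 0 = un ∧ ∀ ℓ < s, uh (ℓ+1) = rkStage c d τ L uσ ℓ ∧ uσ (ℓ+1) = Fτ (uh (ℓ+1))

/-- The full OEDG evolution: `uσ n ℓ = u_σ^{n,ℓ}` and `uh n ℓ = u_h^{n,ℓ}`, starting from
`u_σ^0 = u0`, with `u_σ^{n+1} = u_σ^{n,s}`. -/
def IsOEDGEvol [NeZero N] (s : ℕ) (c d : ℕ → ℕ → ℝ) (τ : ℝ)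
    (L Fτ : (Fin N → Polynomial ℝ) → (Fin N → Polynomial ℝ))
    (u0 : Fin N → Polynomial ℝ) (uh uσ : ℕ → ℕ → Fin N → Polynomial ℝ) : Prop :=
  uσ 0 0 = u0 ∧ ∀ n, uσ (n+1) 0 = uσ n s ∧
    ∀ ℓ < s, uh n (ℓ+1) = rkStage c d τ L (uσ n) ℓ ∧ uσ n (ℓ+1) = Fτ (uh n (ℓ+1))

/-- `p` is the Gauss–Radau projection of `w` on `[a,b]` into `ℙ^k`:
`∫_a^b (w - p) q dx = 0` for all `q ∈ ℙ^{k-1}` and `p(b) = w(b)`. -/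
def IsGRProj (k : ℕ) (a b : ℝ) (w : ℝ → ℝ) (p : Polynomial ℝ) : Prop :=
  p.natDegree ≤ k ∧
  (∀ q : Polynomial ℝ, q.natDegree < k →
    (∫ x in a..b, (w x - p.eval x) * q.eval x) = 0) ∧
  p.eval b = w b

/-- `u = u(x,t)` is a smooth `1`-periodic exact solution of `u_t + β u_x = 0`. -/
def IsSmoothSolution (β : ℝ) (u : ℝ → ℝ → ℝ) : Prop :=
  ContDiff ℝ (⊤ : ℕ∞) (fun p : ℝ × ℝ => u p.1 p.2) ∧
  (∀ x t, u (x+1) t = u x t) ∧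
  (∀ x t, deriv (fun s => u x s) t + β * deriv (fun y => u y t) x = 0)

/-- Auxiliary table for the reference functions `U^{n,ℓ}`. -/
noncomputable def UrefUpTo (u : ℝ → ℝ → ℝ) (c d : ℕ → ℕ → ℝ) (β τ : ℝ) (n : ℕ) :
    ℕ → ℕ → ℝ → ℝ
  | 0 => fun _ => fun x => u x ((n:ℝ) * τ)
  | (ℓ+1) => fun i =>
      if i ≤ ℓ then UrefUpTo u c d β τ n ℓ i
      else fun x => ∑ m ∈ Finset.range (ℓ+1),
        (c ℓ m * UrefUpTo u c d β τ n ℓ m x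
          - τ * d ℓ m * β * deriv (UrefUpTo u c d β τ n ℓ m) x)

/-- Reference function `U^{n,ℓ}` (for `0 ≤ ℓ ≤ s-1`): `U^{n,0} = u(·, t^n)` and
`U^{n,ℓ+1} = ∑_{0≤m≤ℓ} (c_{ℓm} U^{n,m} - τ d_{ℓm} β ∂_x U^{n,m})`. -/
noncomputable def Uref (u : ℝ → ℝ → ℝ) (c d : ℕ → ℕ → ℝ) (β τ : ℝ) (n ℓ : ℕ) : ℝ → ℝ :=
  UrefUpTo u c d β τ n ℓ ℓ

/-- Reference function `U^{n,ℓ}` including the final stage `U^{n,s} := u(·, t^{n+1})`. -/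
noncomputable def UrefS (u : ℝ → ℝ → ℝ) (c d : ℕ → ℕ → ℝ) (β τ : ℝ) (s n ℓ : ℕ) : ℝ → ℝ :=
  if ℓ = s then fun x => u x (((n:ℝ)+1) * τ) else Uref u c d β τ n ℓ

/-- The Runge–Kutta residual `ρ^{n,s-1}`, defined so that
`U^{n,s} = ∑_{0≤m≤s-1} (c_{s-1,m} U^{n,m} - τ d_{s-1,m} β ∂_x U^{n,m}) + τ ρ^{n,s-1}`. -/
noncomputable def rkRes (u : ℝ → ℝ → ℝ) (c d : ℕ → ℕ → ℝ) (β τ : ℝ) (s n : ℕ) : ℝ → ℝ :=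
  fun x => (u x (((n:ℝ)+1) * τ) - ∑ m ∈ Finset.range s,
    (c (s-1) m * Uref u c d β τ n m x
      - τ * d (s-1) m * β * deriv (Uref u c d β τ n m) x)) / τ

/-- `L²(0,1)` norm of a function. -/
noncomputable def fl2 (f : ℝ → ℝ) : ℝ := Real.sqrt (∫ x in (0:ℝ)..1, (f x)^2)

/-- `L²(Ω)` distance between a piecewise polynomial and a function. -/
noncomputable def errL2 (pt : Fin (N+1) → ℝ) (w : Fin N → Polynomial ℝ) (f : ℝ → ℝ) : ℝ :=
  Real.sqrt (∑ j : Fin N, ∫ x in (ptL pt j)..(ptR pt j), ((w j).eval x - f x)^2)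


/-- A weighted `L²` norm on `[0,1]` controls the coefficients of polynomials of bounded degree. -/
theorem exists_coeff_sq_le (k : ℕ) : ∃ c : ℝ, 0 < c ∧ ∀ p : Polynomial ℝ, p.natDegree ≤ k →
    ∀ i, (p.coeff i)^2 ≤ c * ∫ x in (0:ℝ)..1, (1 - x) * (p.eval x)^2 := by
  classical
  let P : (Fin (k+1) → ℝ) → Polynomial ℝ := fun c => ∑ i, C (c i) * X ^ (i : ℕ)
  have hPeval : ∀ c x, (P c).eval x = ∑ i, c i * x ^ (i : ℕ) := by
    intro c x; simp [P, eval_finsetSum]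
  have hPcoeff : ∀ c (i : Fin (k+1)), (P c).coeff i = c i := by
    intro c i
    simp only [P, finsetSum_coeff, coeff_C_mul, coeff_X_pow]
    rw [Finset.sum_eq_single i]
    · simp
    · intro b _ hb
      have : (i : ℕ) ≠ b := fun h => hb (Fin.ext h.symm)
      simp [this]
    · simp
  let F : (Fin (k+1) → ℝ) → ℝ := fun c => ∫ x in (0:ℝ)..1, (1 - x) * ((P c).eval x)^2
  have hFcont : Continuous F := by
    apply intervalIntegral.continuous_parametric_intervalIntegral_of_continuous'
    have : (Function.uncurry fun (c : Fin (k+1) → ℝ) (x : ℝ) => (1 - x) * ((P c).eval x)^2)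
        = fun q => (1 - q.2) * (∑ i : Fin (k+1), q.1 i * q.2 ^ (i : ℕ))^2 := by
      ext q; simp [Function.uncurry, hPeval]
    rw [this]; fun_prop
  have hFpos : ∀ c, c ≠ 0 → 0 < F c := by
    intro c hc
    have hP : P c ≠ 0 := by
      intro h0; apply hc; ext i; rw [← hPcoeff c i, h0]; simp
    apply intervalIntegral.integral_pos zero_lt_one
    · fun_prop
    · intro x hx; have := hx.2; have : 0 ≤ 1 - x := by linarith
      positivity
    · by_contra! hcon
      apply hP
      apply Polynomial.eq_zero_of_infinite_isRoot
      apply (Set.Ioo_infinite (zero_lt_one' ℝ)).mono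
      intro x hx
      have h1 := hcon x ⟨hx.1.le, hx.2.le⟩
      have h2 : 0 < 1 - x := by linarith [hx.2]
      have h3 : ((P c).eval x)^2 ≤ 0 := by
        by_contra! h; exact absurd (mul_pos h2 h) (not_lt.2 h1)
      simpa using le_antisymm h3 (sq_nonneg _)
  obtain ⟨c₁, hc₁, hmin⟩ := (isCompact_sphere (0 : Fin (k+1) → ℝ) 1).exists_isMinOn
    (NormedSpace.sphere_nonempty.2 zero_le_one) hFcont.continuousOn
  have hc₁0 : c₁ ≠ 0 := by
    rintro rfl; simp at hc₁
  have hm := hFpos c₁ hc₁0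
  refine ⟨(F c₁)⁻¹, inv_pos.2 hm, ?_⟩
  intro p hp i
  by_cases hik : k < i
  · rw [coeff_eq_zero_of_natDegree_lt (lt_of_le_of_lt hp hik)]
    have : 0 ≤ ∫ x in (0:ℝ)..1, (1 - x) * (p.eval x)^2 := by
      apply intervalIntegral.integral_nonneg zero_le_one
      intro x hx; have : 0 ≤ 1 - x := by linarith [hx.2]
      positivity
    simpa using mul_nonneg (inv_pos.2 hm).le this
  let c : Fin (k+1) → ℝ := fun i => p.coeff i
  have hpc : P c = p := by
    rw [p.as_sum_range_C_mul_X_pow' (Nat.lt_succ_of_le hp)]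
    simp only [P, c]
    exact Fin.sum_univ_eq_sum_range (fun i => C (p.coeff i) * X ^ i) (k+1)
  have hkey : F c₁ * ‖c‖^2 ≤ F c := by
    by_cases hc : c = 0
    · rw [hc]
      have : F 0 = 0 := by simp [F, hPeval]
      simp [this]
    have hn : 0 < ‖c‖ := norm_pos_iff.2 hc
    have h1 : F c₁ ≤ F (‖c‖⁻¹ • c) := by
      apply hmin
      simp [norm_smul, hn.ne']
    have h2 : F (‖c‖⁻¹ • c) = (‖c‖⁻¹)^2 * F c := by
      simp only [F]
      rw [← intervalIntegral.integral_const_mul]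
      congr 1; ext x
      have : (P (‖c‖⁻¹ • c)).eval x = ‖c‖⁻¹ * (P c).eval x := by
        simp [hPeval, Finset.mul_sum, mul_assoc]
      rw [this]; ring
    rw [h2] at h1
    calc F c₁ * ‖c‖^2 ≤ (‖c‖⁻¹)^2 * F c * ‖c‖^2 := by gcongr
      _ = F c := by field_simp
  have hci : |p.coeff i| ≤ ‖c‖ := norm_le_pi_norm c ⟨i, by omega⟩
  have hFc : F c = ∫ x in (0:ℝ)..1, (1 - x) * (p.eval x)^2 := by simp only [F, hpc]
  rw [← hFc]
  calc (p.coeff i)^2 = |p.coeff i|^2 := (sq_abs _).symm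
    _ ≤ ‖c‖^2 := by gcongr
    _ = (F c₁)⁻¹ * (F c₁ * ‖c‖^2) := by field_simp
    _ ≤ _ := by gcongr

theorem pderiv_succ (m : ℕ) (p : Polynomial ℝ) :
    pderiv (m+1) p = derivative (pderiv m p) := by
  simp only [pderiv]; rw [Function.iterate_succ_apply']

theorem pderiv_sub (m : ℕ) (p q : Polynomial ℝ) :
    pderiv m (p - q) = pderiv m p - pderiv m q := by
  induction m with
  | zero => rfl
  | succ m ih => rw [pderiv_succ, ih, derivative_sub, ← pderiv_succ, ← pderiv_succ]

theorem natDegree_pderiv_le {k : ℕ} (m : ℕ) {p : Polynomial ℝ} (hp : p.natDegree ≤ k) :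
    (pderiv m p).natDegree ≤ k := by
  induction m with
  | zero => exact hp
  | succ m ih =>
    rw [pderiv_succ]
    exact (natDegree_derivative_le _).trans (by omega)

theorem pderiv_comp_affine (m : ℕ) (p : Polynomial ℝ) (l a : ℝ) :
    pderiv m (p.comp (C l * X + C a)) = C (l^m) * (pderiv m p).comp (C l * X + C a) := by
  induction m with
  | zero => simp [pderiv]
  | succ m ih =>
    rw [pderiv_succ, ih, pderiv_succ, derivative_C_mul, derivative_comp]
    simp [pow_succ]; ring

theorem abs_eval_pderiv_le {k : ℕ} {p : Polynomial ℝ} (hp : p.natDegree ≤ k) {A : ℝ}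
    (hA : ∀ i, |p.coeff i| ≤ A) (m : ℕ) {s : ℝ} (hs : s ∈ Set.Icc (0:ℝ) 1) :
    |(pderiv m p).eval s| ≤ ((k:ℝ)+1)^(m+1) * A := by
  have hA0 : 0 ≤ A := (abs_nonneg _).trans (hA 0)
  have hcoeff : ∀ i, |(pderiv m p).coeff i| ≤ ((k:ℝ)+1)^m * A := by
    induction m with
    | zero => simpa [pderiv] using hA
    | succ m ih =>
      intro i
      rw [pderiv_succ, coeff_derivative, abs_mul]
      by_cases hi : k < i + 1
      · rw [coeff_eq_zero_of_natDegree_lt ((natDegree_pderiv_le m hp).trans_lt hi)]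
        simp; positivity
      · have h1 : ((i:ℝ)+1) ≤ k + 1 := by
          have : i ≤ k := by omega
          have : (i:ℝ) ≤ k := by exact_mod_cast this
          linarith
        have h2 : |(i:ℝ)+1| ≤ k + 1 := by rwa [abs_of_nonneg (by positivity)]
        calc _ ≤ (((k:ℝ)+1)^m * A) * (k+1) := by gcongr; exact ih _
          _ = _ := by ring
  rw [eval_eq_sum_range' (Nat.lt_succ_of_le (natDegree_pderiv_le m hp))]
  calc _ ≤ ∑ i ∈ range (k+1), |(pderiv m p).coeff i * s^i| := Finset.abs_sum_le_sum_abs _ _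
    _ ≤ ∑ i ∈ range (k+1), ((k:ℝ)+1)^m * A := by
      apply Finset.sum_le_sum
      intro i _
      rw [abs_mul, abs_of_nonneg (pow_nonneg hs.1 i)]
      have := pow_le_one₀ (n := i) hs.1 hs.2
      calc _ ≤ ((k:ℝ)+1)^m * A * 1 := by
            gcongr
            · exact pow_nonneg hs.1 i
            · exact hcoeff i
        _ = _ := mul_one _
    _ = _ := by simp; ring

/-- Inverse inequality, with the right-hand side in a weighted `L²` norm. -/
theorem exists_weighted_inverse (k : ℕ) : ∃ c : ℝ, 0 < c ∧ ∀ a b : ℝ, a < b →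
    ∀ p : Polynomial ℝ, p.natDegree ≤ k → ∀ m ≤ k, ∀ x ∈ Set.Icc a b,
      ((b-a)^m * (pderiv m p).eval x)^2 * (b-a)^2 ≤ c * ∫ y in a..b, (b-y) * (p.eval y)^2 := by
  obtain ⟨c, hc, h⟩ := exists_coeff_sq_le k
  refine ⟨(((k:ℝ)+1)^(k+1))^2 * c, by positivity, ?_⟩
  intro a b hab p hp m hm x hx
  set l := b - a with hl
  have hl0 : 0 < l := sub_pos.2 hab
  set q := p.comp (C l * X + C a) with hq
  have hqd : q.natDegree ≤ k := by
    rw [hq]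
    refine natDegree_comp_le.trans ?_
    have : (C l * X + C a : Polynomial ℝ).natDegree ≤ 1 := natDegree_linear_le
    nlinarith
  set I := ∫ x in (0:ℝ)..1, (1 - x) * (q.eval x)^2 with hI
  have hA : ∀ i, |q.coeff i| ≤ √(c * I) := fun i => Real.abs_le_sqrt (h q hqd i)
  have hI0 : 0 ≤ c * I := (sq_nonneg _).trans (h q hqd 0)
  have hs : (x - a)/l ∈ Set.Icc (0:ℝ) 1 :=
    ⟨div_nonneg (by linarith [hx.1]) hl0.le, (div_le_one hl0).2 (by linarith [hx.2])⟩
  have hb := abs_eval_pderiv_le hqd hA m hs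
  rw [hq, pderiv_comp_affine] at hb
  have he : (C (l^m) * (pderiv m p).comp (C l * X + C a)).eval ((x-a)/l)
      = l^m * (pderiv m p).eval x := by
    simp only [eval_mul, eval_C, eval_comp, eval_add, eval_X]
    congr 2; field_simp; ring
  rw [he] at hb
  have hscale : ∫ y in a..b, (b-y) * (p.eval y)^2 = l^2 * I := by
    have := intervalIntegral.smul_integral_comp_mul_add
      (a := 0) (b := 1) (fun y => (b-y) * (p.eval y)^2) l a
    simp only [mul_zero, zero_add, mul_one, smul_eq_mul] at this
    rw [show l + a = b by rw [hl]; ring] at this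
    rw [← this, hI, ← intervalIntegral.integral_const_mul, ← intervalIntegral.integral_const_mul]
    congr 1; ext s
    simp only [hq, eval_comp, eval_add, eval_mul, eval_C, eval_X]
    rw [hl]; ring
  have hk1 : (1:ℝ) ≤ (k:ℝ)+1 := by linarith [(Nat.cast_nonneg k : (0:ℝ) ≤ k)]
  calc (l^m * (pderiv m p).eval x)^2 * l^2 = |l^m * (pderiv m p).eval x|^2 * l^2 := by
        rw [sq_abs]
    _ ≤ (((k:ℝ)+1)^(k+1) * √(c * I))^2 * l^2 := by
        gcongr
        refine hb.trans ?_
        gcongr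
    _ = _ := by rw [hscale, mul_pow, Real.sq_sqrt hI0]; ring

/-- Inverse inequality between `L²` and the endpoint (or interior) values of derivatives. -/
theorem exists_inverse (k : ℕ) : ∃ c : ℝ, 0 < c ∧ ∀ a b : ℝ, a < b →
    ∀ p : Polynomial ℝ, p.natDegree ≤ k → ∀ m ≤ k, ∀ x ∈ Set.Icc a b,
      ((b-a)^m * (pderiv m p).eval x)^2 * (b-a) ≤ c * ∫ y in a..b, p.eval y * p.eval y := by
  obtain ⟨c, hc, h⟩ := exists_weighted_inverse k
  refine ⟨c, hc, ?_⟩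
  intro a b hab p hp m hm x hx
  have hl0 : 0 < b - a := sub_pos.2 hab
  have h1 := h a b hab p hp m hm x hx
  have h2 : ∫ y in a..b, (b-y) * (p.eval y)^2 ≤ ∫ y in a..b, (b-a) * (p.eval y * p.eval y) := by
    apply intervalIntegral.integral_mono_on hab.le
    · exact Continuous.intervalIntegrable (by fun_prop) _ _
    · exact Continuous.intervalIntegrable (by fun_prop) _ _
    · intro y hy
      have : b - y ≤ b - a := by linarith [hy.1]
      nlinarith [mul_le_mul_of_nonneg_right this (sq_nonneg (p.eval y))]
  rw [intervalIntegral.integral_const_mul] at h2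
  have h3 := h1.trans (mul_le_mul_of_nonneg_left h2 hc.le)
  refine le_of_mul_le_mul_right ?_ hl0
  nlinarith

/-- The Taylor polynomial of degree at most `k` with prescribed derivatives at `x₀`. -/
theorem exists_polynomial_pderiv_eval (k : ℕ) (x₀ : ℝ) (d : ℕ → ℝ) :
    ∃ T : Polynomial ℝ, T.natDegree ≤ k ∧ ∀ m ≤ k, (pderiv m T).eval x₀ = d m := by
  let Q : Polynomial ℝ := ∑ i ∈ range (k+1), C (d i / (Nat.factorial i : ℝ)) * X ^ i
  have hQd : Q.natDegree ≤ k := by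
    apply natDegree_sum_le_of_forall_le
    intro i hi
    exact (natDegree_C_mul_X_pow_le _ _).trans (Nat.lt_succ_iff.1 (mem_range.1 hi))
  have hQc : ∀ m ≤ k, Q.coeff m = d m / (Nat.factorial m : ℝ) := by
    intro m hm
    simp only [Q, finsetSum_coeff, coeff_C_mul, coeff_X_pow]
    rw [Finset.sum_eq_single m]
    · simp
    · intro b _ hb; simp [hb.symm]
    · intro h; exact absurd (mem_range.2 (Nat.lt_succ_of_le hm)) h
  refine ⟨Q.comp (C 1 * X + C (-x₀)), ?_, ?_⟩
  · refine natDegree_comp_le.trans ?_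
    have : (C 1 * X + C (-x₀) : Polynomial ℝ).natDegree ≤ 1 := natDegree_linear_le
    nlinarith
  · intro m hm
    rw [pderiv_comp_affine]
    simp only [one_pow, map_one, one_mul, eval_comp, eval_add, eval_X, eval_C, add_neg_cancel]
    rw [← coeff_zero_eq_eval_zero]
    have : pderiv m Q = derivative^[m] Q := rfl
    rw [this, coeff_iterate_derivative, zero_add, hQc m hm, Nat.descFactorial_self, nsmul_eq_mul]
    have : (Nat.factorial m : ℝ) ≠ 0 := by exact_mod_cast m.factorial_ne_zero
    field_simp

theorem pderiv_eq_zero_of_natDegree_lt {p : Polynomial ℝ} {m : ℕ} (h : p.natDegree < m) :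
    pderiv m p = 0 :=
  iterate_derivative_eq_zero h

/-- Taylor's theorem with all intermediate derivatives, on an interval `[a,b]`. -/
theorem exists_taylor {k : ℕ} {M : ℝ} {U : ℝ → ℝ} (hU : ContDiff ℝ (k+1) U)
    (hM : ∀ x, |iteratedDeriv (k+1) U x| ≤ M) {a b : ℝ} (hab : a < b) :
    ∃ T : Polynomial ℝ, T.natDegree ≤ k ∧ ∀ m ≤ k, ∀ x ∈ Set.Icc a b,
      |iteratedDeriv m U x - (pderiv m T).eval x| ≤ M * (b-a)^(k+1-m) := by
  obtain ⟨T, hTd, hT⟩ := exists_polynomial_pderiv_eval k a (fun m => iteratedDeriv m U a)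
  refine ⟨T, hTd, ?_⟩
  have hl0 : 0 < b - a := sub_pos.2 hab
  have hM0 : 0 ≤ M := (abs_nonneg _).trans (hM 0)
  have hstep : ∀ m ≤ k, ∀ x, HasDerivAt (fun x => iteratedDeriv m U x - (pderiv m T).eval x)
      (iteratedDeriv (m+1) U x - (pderiv (m+1) T).eval x) x := by
    intro m hm x
    rw [pderiv_succ, iteratedDeriv_succ]
    refine HasDerivAt.sub ?_ (Polynomial.hasDerivAt _ x)
    refine DifferentiableAt.hasDerivAt ?_
    refine (hU.differentiable_iteratedDeriv m ?_) x
    exact_mod_cast Nat.lt_succ_of_le hm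
  have hmain : ∀ n ≤ k+1, ∀ x ∈ Set.Icc a b,
      |iteratedDeriv (k+1-n) U x - (pderiv (k+1-n) T).eval x| ≤ M * (b-a)^n := by
    intro n
    induction n with
    | zero =>
      intro _ x _
      rw [Nat.sub_zero, pderiv_eq_zero_of_natDegree_lt (Nat.lt_succ_of_le hTd)]
      simpa using hM x
    | succ n ih =>
      intro hn x hx
      obtain ⟨r, hr⟩ : ∃ r, r = k + 1 - (n+1) := ⟨_, rfl⟩
      have hr1 : k + 1 - n = r + 1 := by omega
      rw [← hr]
      rw [hr1] at ih
      have := (convex_Icc a b).norm_image_sub_le_of_norm_hasDerivWithin_le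
        (f := fun x => iteratedDeriv r U x - (pderiv r T).eval x)
        (f' := fun x => iteratedDeriv (r+1) U x - (pderiv (r+1) T).eval x)
        (C := M * (b-a)^n)
        (fun y _ => (hstep r (by omega) y).hasDerivWithinAt)
        (fun y hy => ih (by omega) y hy) (Set.left_mem_Icc.2 hab.le) hx
      simp only [hT r (by omega), sub_self, sub_zero, Real.norm_eq_abs] at this
      refine this.trans ?_
      have hxa : |x - a| ≤ b - a := by
        rw [abs_of_nonneg (by linarith [hx.1])]; linarith [hx.2]
      calc _ ≤ M * (b-a)^n * (b-a) := by gcongr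
        _ = _ := by ring
  intro m hm x hx
  have := hmain (k+1-m) (by omega) x hx
  rwa [show k + 1 - (k+1-m) = m by omega] at this

/-- Sup-norm stability of the Gauss–Radau projection. -/
theorem exists_GRProj_stability (k : ℕ) : ∃ c : ℝ, 0 < c ∧ ∀ a b : ℝ, a < b →
    ∀ (w : ℝ → ℝ) (S : ℝ), Continuous w → (∀ x ∈ Set.Icc a b, |w x| ≤ S) →
    ∀ q : Polynomial ℝ, IsGRProj k a b w q → ∀ x ∈ Set.Icc a b, |q.eval x| ≤ c * S := by
  obtain ⟨c, hc, hinv⟩ := exists_weighted_inverse k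
  refine ⟨1 + 2 * c, by positivity, ?_⟩
  intro a b hab w S hw hS q ⟨hqd, hqo, hqb⟩ x hx
  have hl0 : 0 < b - a := sub_pos.2 hab
  have hbI := Set.right_mem_Icc.2 hab.le
  have hS0 : 0 ≤ S := (abs_nonneg _).trans (hS b hbI)
  obtain ⟨g, hg⟩ : (X - C b) ∣ q - C (q.eval b) := by
    rw [dvd_iff_isRoot]; simp
  have hqe : ∀ y, q.eval y = w b + (y - b) * g.eval y := by
    intro y
    have := congrArg (eval y) hg
    simp only [eval_sub, eval_C, eval_mul, eval_X] at this
    linarith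
  by_cases hg0 : g = 0
  · rw [hqe x, hg0]
    simp only [eval_zero, mul_zero, add_zero]
    nlinarith [hS b hbI]
  have hgd : g.natDegree < k := by
    have h1 : (q - C (q.eval b)).natDegree = g.natDegree + 1 := by
      rw [hg, natDegree_mul (X_sub_C_ne_zero b) hg0, natDegree_X_sub_C]; ring
    rw [natDegree_sub_C] at h1
    omega
  set J := ∫ y in a..b, (b-y) * (g.eval y)^2 with hJ
  have hgb : ∀ y ∈ Set.Icc a b, (g.eval y)^2 * (b-a)^2 ≤ c * J := by
    intro y hy
    simpa [pderiv] using hinv a b hab g hgd.le 0 (Nat.zero_le _) y hy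
  have hJ0 : 0 ≤ c * J := le_trans (by positivity) (hgb b hbI)
  set G := √(c * J) / (b-a) with hG
  have hG0 : 0 ≤ G := by positivity
  have hGJ : G^2 * (b-a)^2 = c * J := by
    rw [hG, div_pow, Real.sq_sqrt hJ0]; field_simp
  have hgG : ∀ y ∈ Set.Icc a b, |g.eval y| ≤ G := by
    intro y hy
    apply abs_le_of_sq_le_sq _ hG0
    have := hgb y hy
    rw [← hGJ] at this
    exact le_of_mul_le_mul_right this (by positivity)
  have hJle : J ≤ 2 * S * G * (b-a) := by
    have h1 : J = ∫ y in a..b, (w b - w y) * g.eval y := by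
      have h2 := hqo g hgd
      have h3 : ∀ y, (w b - w y) * g.eval y
          = (b-y) * (g.eval y)^2 - (w y - q.eval y) * g.eval y := by
        intro y; rw [hqe y]; ring
      simp only [h3]
      rw [intervalIntegral.integral_sub, h2, sub_zero]
      · exact Continuous.intervalIntegrable (by fun_prop) _ _
      · exact Continuous.intervalIntegrable (by fun_prop) _ _
    have h4 := intervalIntegral.norm_integral_le_of_norm_le_const (a := a) (b := b)
      (f := fun y => (w b - w y) * g.eval y) (C := 2 * S * G) (by
        intro y hy
        rw [Set.uIoc_of_le hab.le] at hy
        have hy' : y ∈ Set.Icc a b := ⟨hy.1.le, hy.2⟩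
        rw [Real.norm_eq_abs, abs_mul]
        have : |w b - w y| ≤ 2 * S := by
          have := abs_sub (w b) (w y)
          linarith [hS b hbI, hS y hy']
        gcongr
        exact hgG y hy')
    rw [← h1, abs_of_pos hl0] at h4
    exact (le_abs_self _).trans h4
  have hGle : G * (b-a) ≤ 2 * c * S := by
    by_cases hGz : G = 0
    · rw [hGz]; simp; positivity
    have hGp : 0 < G := lt_of_le_of_ne hG0 (Ne.symm hGz)
    have h5 : G^2 * (b-a)^2 ≤ c * (2 * S * G * (b-a)) := by
      rw [hGJ]; gcongr
    have h6 : 0 < G * (b-a) := by positivity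
    refine le_of_mul_le_mul_right ?_ h6
    nlinarith
  rw [hqe x]
  calc |w b + (x-b) * g.eval x| ≤ |w b| + |(x-b) * g.eval x| := abs_add_le _ _
    _ ≤ S + (b-a) * G := by
      rw [abs_mul]
      have : |x - b| ≤ b - a := by rw [abs_le]; constructor <;> linarith [hx.1, hx.2]
      have h1 := hgG x hx
      have h2 := hS b hbI
      gcongr
    _ ≤ _ := by nlinarith

theorem IsGRProj.sub_polynomial {k : ℕ} {a b : ℝ} {w : ℝ → ℝ}
    {p T : Polynomial ℝ} (hp : IsGRProj k a b w p) (hT : T.natDegree ≤ k) :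
    IsGRProj k a b (fun x => w x - T.eval x) (p - T) := by
  refine ⟨(natDegree_sub_le _ _).trans (max_le hp.1 hT), ?_, ?_⟩
  · intro q hq
    rw [← hp.2.1 q hq]
    congr 1; ext x
    rw [eval_sub]; ring
  · rw [eval_sub, hp.2.2]

/-- Approximation by the Gauss–Radau projection, including all derivatives. -/
theorem exists_GRProj_approx (k : ℕ) : ∃ c : ℝ, 0 < c ∧ ∀ (M : ℝ) (U : ℝ → ℝ),
    ContDiff ℝ (k+1) U → (∀ x, |iteratedDeriv (k+1) U x| ≤ M) → ∀ a b : ℝ, a < b →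
    ∀ p : Polynomial ℝ, IsGRProj k a b U p → ∀ m ≤ k, ∀ x ∈ Set.Icc a b,
      (b-a)^m * |(pderiv m p).eval x - iteratedDeriv m U x| ≤ c * M * (b-a)^(k+1) := by
  obtain ⟨c₁, hc₁, hinv⟩ := exists_inverse k
  obtain ⟨c₂, hc₂, hst⟩ := exists_GRProj_stability k
  refine ⟨√c₁ * c₂ + 1, by positivity, ?_⟩
  intro M U hU hM a b hab p hp m hm x hx
  have hl0 : 0 < b - a := sub_pos.2 hab
  have hM0 : 0 ≤ M := (abs_nonneg _).trans (hM 0)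
  obtain ⟨T, hTd, hT⟩ := exists_taylor hU hM hab
  have hq := hp.sub_polynomial hTd
  have hqS := hst a b hab _ (M * (b-a)^(k+1)) (hU.continuous.sub T.continuous)
    (by intro y hy; simpa [pderiv] using hT 0 (Nat.zero_le _) y hy) _ hq
  set B := c₂ * (M * (b-a)^(k+1)) with hB
  have hB0 : 0 ≤ B := by positivity
  have hint : ∫ y in a..b, (p - T).eval y * (p - T).eval y ≤ B^2 * (b-a) := by
    have : ∫ y in a..b, (p - T).eval y * (p - T).eval y ≤ ∫ y in a..b, B^2 := by
      apply intervalIntegral.integral_mono_on hab.le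
      · exact Continuous.intervalIntegrable (by fun_prop) _ _
      · exact intervalIntegrable_const
      · intro y hy
        rw [← sq, ← sq_abs]
        have := hqS y hy
        gcongr
    simpa [mul_comm] using this
  have h1 := (hinv a b hab _ hq.1 m hm x hx).trans (mul_le_mul_of_nonneg_left hint hc₁.le)
  have h2 : |(b-a)^m * (pderiv m (p-T)).eval x| ≤ √c₁ * B := by
    apply abs_le_of_sq_le_sq _ (by positivity)
    rw [mul_pow (√c₁), Real.sq_sqrt hc₁.le]
    refine le_of_mul_le_mul_right ?_ hl0
    linarith
  rw [abs_mul, abs_of_pos (by positivity), pderiv_sub, eval_sub] at h2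
  have h3 := hT m hm x hx
  have h4 : (b-a)^m * |iteratedDeriv m U x - (pderiv m T).eval x| ≤ M * (b-a)^(k+1) := by
    calc _ ≤ (b-a)^m * (M * (b-a)^(k+1-m)) := by gcongr
      _ = M * ((b-a)^m * (b-a)^(k+1-m)) := by ring
      _ = _ := by rw [← pow_add, show m + (k+1-m) = k+1 by omega]
  have h5 : |(pderiv m p).eval x - iteratedDeriv m U x|
      ≤ |(pderiv m p).eval x - (pderiv m T).eval x|
        + |iteratedDeriv m U x - (pderiv m T).eval x| := by
    rw [abs_sub_comm (iteratedDeriv m U x)]; exact abs_sub_le _ _ _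
  calc _ ≤ (b-a)^m * (|(pderiv m p).eval x - (pderiv m T).eval x|
        + |iteratedDeriv m U x - (pderiv m T).eval x|) := by gcongr
    _ ≤ √c₁ * B + M * (b-a)^(k+1) := by rw [mul_add]; exact add_le_add h2 h4
    _ = _ := by rw [hB]; ring

theorem IsMesh.ptL_lt_ptR {pt : Fin (N+1) → ℝ} (h : IsMesh pt) (j : Fin N) :
    ptL pt j < ptR pt j :=
  h.2.2 (Fin.castSucc_lt_succ)

theorem cip_comm (pt : Fin (N+1) → ℝ) (j : Fin N) (p q : Polynomial ℝ) :
    cip pt j p q = cip pt j q p := by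
  simp only [cip, mul_comm]

theorem cip_add_left (pt : Fin (N+1) → ℝ) (j : Fin N) (p q r : Polynomial ℝ) :
    cip pt j (p + q) r = cip pt j p r + cip pt j q r := by
  simp only [cip, eval_add, add_mul]
  apply intervalIntegral.integral_add <;>
    exact Continuous.intervalIntegrable (by fun_prop) _ _

theorem cip_sub_left (pt : Fin (N+1) → ℝ) (j : Fin N) (p q r : Polynomial ℝ) :
    cip pt j (p - q) r = cip pt j p r - cip pt j q r := by
  simp only [cip, eval_sub, sub_mul]
  apply intervalIntegral.integral_sub <;>
    exact Continuous.intervalIntegrable (by fun_prop) _ _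

theorem cip_sub_right (pt : Fin (N+1) → ℝ) (j : Fin N) (p q r : Polynomial ℝ) :
    cip pt j p (q - r) = cip pt j p q - cip pt j p r := by
  rw [cip_comm, cip_sub_left, cip_comm, cip_comm pt j r]

theorem cip_C_mul_left (pt : Fin (N+1) → ℝ) (j : Fin N) (c : ℝ) (p q : Polynomial ℝ) :
    cip pt j (C c * p) q = c * cip pt j p q := by
  simp only [cip, eval_mul, eval_C, mul_assoc]
  exact intervalIntegral.integral_const_mul _ _

theorem cip_self_nonneg {pt : Fin (N+1) → ℝ} (hpt : IsMesh pt) (j : Fin N) (p : Polynomial ℝ) :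
    0 ≤ cip pt j p p :=
  intervalIntegral.integral_nonneg (hpt.ptL_lt_ptR j).le fun _ _ => mul_self_nonneg _

theorem eq_zero_of_cip_self_eq_zero {pt : Fin (N+1) → ℝ} (hpt : IsMesh pt) (j : Fin N)
    {p : Polynomial ℝ} (h : cip pt j p p = 0) : p = 0 := by
  by_contra hp
  apply h.not_gt
  apply intervalIntegral.integral_pos (hpt.ptL_lt_ptR j)
  · fun_prop
  · intro x _; exact mul_self_nonneg _
  · by_contra! hcon
    apply hp
    apply Polynomial.eq_zero_of_infinite_isRoot
    apply (Set.Ioo_infinite (hpt.ptL_lt_ptR j)).mono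
    intro x hx
    have h1 := hcon x ⟨hx.1.le, hx.2.le⟩
    exact mul_self_eq_zero.1 (le_antisymm h1 (mul_self_nonneg _))

theorem cl2_nonneg (pt : Fin (N+1) → ℝ) (j : Fin N) (p : Polynomial ℝ) : 0 ≤ cl2 pt j p :=
  Real.sqrt_nonneg _

theorem cl2_sq {pt : Fin (N+1) → ℝ} (hpt : IsMesh pt) (j : Fin N) (p : Polynomial ℝ) :
    cl2 pt j p ^ 2 = cip pt j p p :=
  Real.sq_sqrt (cip_self_nonneg hpt j p)

/-- Cauchy–Schwarz on a cell. -/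
theorem abs_cip_le {pt : Fin (N+1) → ℝ} (hpt : IsMesh pt) (j : Fin N) (p q : Polynomial ℝ) :
    |cip pt j p q| ≤ cl2 pt j p * cl2 pt j q := by
  have h : discrim (cip pt j q q) (2 * cip pt j p q) (cip pt j p p) ≤ 0 := by
    apply discrim_le_zero
    intro t
    have h1 := cip_self_nonneg hpt j (C t * q + p)
    rw [cip_add_left, cip_C_mul_left, cip_comm pt j q, cip_comm pt j p (C t * q + p),
      cip_add_left, cip_add_left, cip_C_mul_left, cip_C_mul_left, cip_comm pt j q p] at h1
    linarith
  rw [discrim] at h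
  apply abs_le_of_sq_le_sq _ (mul_nonneg (cl2_nonneg _ _ _) (cl2_nonneg _ _ _))
  rw [mul_pow, cl2_sq hpt, cl2_sq hpt]
  linarith

theorem IsCellProj.eq_self {pt : Fin (N+1) → ℝ} (hpt : IsMesh pt)
    {Pc : Fin N → ℕ → Polynomial ℝ → Polynomial ℝ} (hPc : IsCellProj pt Pc) (j : Fin N)
    {d : ℕ} {p : Polynomial ℝ} (hp : p.natDegree ≤ d) : Pc j d p = p := by
  obtain ⟨h1, h2⟩ := hPc j d p
  have := h2 (p - Pc j d p) ((natDegree_sub_le _ _).trans (max_le hp h1))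
  exact (sub_eq_zero.1 (eq_zero_of_cip_self_eq_zero hpt j this)).symm

/-- Exponential decay moves the initial value by at most `l * τ` times its size. -/
theorem abs_sub_le_of_hasDerivAt_neg_mul {f : ℝ → ℝ} {l τ : ℝ} (hl : 0 ≤ l) (hτ : 0 < τ)
    (hf : ∀ t, HasDerivAt f (-(l * f t)) t) : |f τ - f 0| ≤ l * τ * |f 0| := by
  have hd : ∀ t, HasDerivAt (fun t => f t * Real.exp (l * t)) 0 t := by
    intro t
    have h1 : HasDerivAt (fun t => Real.exp (l * t)) (Real.exp (l * t) * l) t := by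
      simpa using ((hasDerivAt_id t).const_mul l).exp
    have h2 := (hf t).fun_mul h1
    rwa [show -(l * f t) * Real.exp (l * t) + f t * (Real.exp (l * t) * l) = 0 by ring] at h2
  have hc : f τ * Real.exp (l * τ) = f 0 := by
    have := is_const_of_deriv_eq_zero (fun t => (hd t).differentiableAt)
      (fun t => (hd t).deriv) τ 0
    simpa using this
  have hfτ : f τ = f 0 * Real.exp (-(l * τ)) := by
    rw [← hc, mul_assoc, ← Real.exp_add]; simp
  rw [hfτ, show f 0 * Real.exp (-(l * τ)) - f 0 = -((1 - Real.exp (-(l*τ))) * f 0) by ring,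
    abs_neg, abs_mul]
  have h1 : Real.exp (-(l*τ)) ≤ 1 := Real.exp_le_one_iff.2 (by nlinarith [mul_nonneg hl hτ.le])
  have h2 := Real.add_one_le_exp (-(l*τ))
  rw [abs_of_nonneg (sub_nonneg.2 h1)]
  gcongr
  linarith

/-- On each cell the damping flow displaces its initial data by at most `τ` times the total
damping rate times the distance of the data to constants. -/
theorem cl2_damping_sub_le [NeZero N] {k : ℕ} {pt : Fin (N+1) → ℝ} (hpt : IsMesh pt)
    {β : Fin N → ℝ} {Pc : Fin N → ℕ → Polynomial ℝ → Polynomial ℝ} (hPc : IsCellProj pt Pc)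
    {u : Fin N → Polynomial ℝ} (hu : MemVk k u) {w : ℝ → Fin N → Polynomial ℝ}
    (hw : IsDampingSol k pt β Pc u w) {τ : ℝ} (hτ : 0 < τ) (j : Fin N)
    (hδ : 0 < k → ∀ m, 0 ≤ dampRate k pt β u m j) (c : ℝ) :
    cl2 pt j (w τ j - u j) ≤
      k * ((∑ m ∈ range (k+1), dampRate k pt β u m j) * τ * cl2 pt j (u j - C c)) := by
  obtain ⟨hw0, hwd, hwt⟩ := hw
  set z := w τ j - u j with hz
  set L := ∑ m ∈ range (k+1), dampRate k pt β u m j with hL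
  set D := cl2 pt j (u j - C c) with hD
  have hzd : z.natDegree ≤ k := (natDegree_sub_le _ _).trans (max_le (hwd τ j) (hu j))
  -- constants are not damped
  have hzero : cip pt j z (Pc j 0 z) = 0 := by
    have hder : ∀ t, HasDerivAt (fun s => cip pt j (w s j) (Pc j 0 z))
        (-(0 * cip pt j (w t j) (Pc j 0 z))) t := by
      intro t
      convert hwt t j (Pc j 0 z) ((hPc j 0 z).1.trans (Nat.zero_le _)) using 2
      rw [zero_mul]
      symm
      apply Finset.sum_eq_zero
      intro m _
      rw [(hPc j (m-1) (w t j)).2 _ ((hPc j 0 z).1.trans (Nat.zero_le _)), mul_zero]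
    have := abs_sub_le_of_hasDerivAt_neg_mul le_rfl hτ hder
    rw [zero_mul, zero_mul, hw0, ← cip_sub_left] at this
    exact abs_nonpos_iff.1 this
  have hmode : ∀ i < k, cip pt j z (Pc j (i+1) z - Pc j i z) ≤ L * τ * D * cl2 pt j z := by
    intro i hi
    have hk : 0 < k := by omega
    set v := Pc j (i+1) z - Pc j i z with hv
    have hvd : v.natDegree ≤ i + 1 := (natDegree_sub_le _ _).trans
      (max_le (hPc j (i+1) z).1 ((hPc j i z).1.trans (Nat.le_succ i)))
    have hvo : ∀ q : Polynomial ℝ, q.natDegree ≤ i → cip pt j q v = 0 := by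
      intro q hq
      have h1 := (hPc j (i+1) z).2 q (hq.trans (Nat.le_succ i))
      have h2 := (hPc j i z).2 q hq
      rw [cip_comm, hv, show Pc j (i+1) z - Pc j i z
        = (z - Pc j i z) - (z - Pc j (i+1) z) by ring, cip_sub_left, h1, h2, sub_zero]
    set l := ∑ m ∈ range (k+1), if m ≤ i + 1 then dampRate k pt β u m j else 0 with hl
    have hl0 : 0 ≤ l := Finset.sum_nonneg fun m _ => by
      split_ifs
      · exact hδ hk m
      · exact le_rfl
    have hlL : l ≤ L := Finset.sum_le_sum fun m _ => by
      split_ifs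
      · exact le_rfl
      · exact hδ hk m
    have hder : ∀ t, HasDerivAt (fun s => cip pt j (w s j) v)
        (-(l * cip pt j (w t j) v)) t := by
      intro t
      convert hwt t j v (hvd.trans hi) using 2
      rw [hl, Finset.sum_mul]
      apply Finset.sum_congr rfl
      intro m _
      split_ifs with hm
      · rw [cip_sub_left, hvo _ ((hPc j (m-1) (w t j)).1.trans (by omega)), sub_zero]
      · rw [(hPc j (m-1) (w t j)).2 v (hvd.trans (by omega)), zero_mul, mul_zero]
    have hflow := abs_sub_le_of_hasDerivAt_neg_mul hl0 hτ hder
    simp only [hw0] at hflow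
    rw [← cip_sub_left, ← hz] at hflow
    have huv : cip pt j (u j) v = cip pt j (u j - C c) v := by
      rw [cip_sub_left, hvo (C c) (by simp), sub_zero]
    rw [huv] at hflow
    have hvv : cip pt j v v = cip pt j z v := by
      have h1 := (hPc j (i+1) z).2 v hvd
      have h2 := hvo _ (hPc j i z).1
      rw [cip_sub_left] at h1
      conv_lhs => rw [hv, cip_sub_left, h2]
      linarith
    have hvz : cl2 pt j v ≤ cl2 pt j z := by
      have h1 := (le_abs_self _).trans (abs_cip_le hpt j z v)
      rw [← hvv, ← cl2_sq hpt, sq] at h1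
      by_cases h0 : cl2 pt j v = 0
      · rw [h0]; exact cl2_nonneg _ _ _
      · exact le_of_mul_le_mul_right h1 (lt_of_le_of_ne (cl2_nonneg _ _ _) (Ne.symm h0))
    calc cip pt j z v ≤ |cip pt j z v| := le_abs_self _
      _ ≤ l * τ * |cip pt j (u j - C c) v| := hflow
      _ ≤ L * τ * (D * cl2 pt j z) := by
        have h1 := abs_cip_le hpt j (u j - C c) v
        have h2 : D * cl2 pt j v ≤ D * cl2 pt j z :=
          mul_le_mul_of_nonneg_left hvz (cl2_nonneg _ _ _)
        have h3 := h1.trans h2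
        have h4 : 0 ≤ L := hl0.trans hlL
        gcongr
      _ = _ := by ring
  have htel : ∀ n ≤ k, cip pt j z (Pc j n z) ≤ n * (L * τ * D * cl2 pt j z) := by
    intro n
    induction n with
    | zero => intro _; rw [hzero]; simp
    | succ n ih =>
      intro hn
      have h1 := ih (by omega)
      have h2 := hmode n (by omega)
      rw [cip_sub_right] at h2
      push_cast
      linarith
  have hfin := htel k le_rfl
  rw [hPc.eq_self hpt j hzd, ← cl2_sq hpt] at hfin
  by_cases h0 : cl2 pt j z = 0
  · rw [h0]
    rcases Nat.eq_zero_or_pos k with hk | hk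
    · rw [hk]; simp
    · have : 0 ≤ L := Finset.sum_nonneg fun m _ => hδ hk m
      have : 0 ≤ D := cl2_nonneg _ _ _
      positivity
  · refine le_of_mul_le_mul_right ?_ (lt_of_le_of_ne (cl2_nonneg pt j z) (Ne.symm h0))
    linarith

theorem cellh_pos {pt : Fin (N+1) → ℝ} (hpt : IsMesh pt) (j : Fin N) : 0 < cellh pt j :=
  sub_pos.2 (hpt.ptL_lt_ptR j)

theorem cellh_le_meshSize (pt : Fin (N+1) → ℝ) (j : Fin N) : cellh pt j ≤ meshSize pt :=
  le_ciSup (Set.finite_range (cellh pt)).bddAbove j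

theorem sum_cellh {pt : Fin (N+1) → ℝ} (hpt : IsMesh pt) : ∑ j, cellh pt j = 1 := by
  have h1 := Fin.sum_univ_succ pt
  rw [Fin.sum_univ_castSucc pt, hpt.1, hpt.2.1] at h1
  simp only [cellh, ptL, ptR, Finset.sum_sub_distrib]
  linarith

theorem card_mul_meshSize_le {pt : Fin (N+1) → ℝ} (hpt : IsMesh pt) {γ : ℝ}
    (hq : QuasiUniform pt γ) : N * meshSize pt ≤ γ := by
  have h : ∑ _j : Fin N, meshSize pt ≤ ∑ j, γ * cellh pt j := Finset.sum_le_sum fun j _ => hq j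
  rw [← Finset.mul_sum, sum_cellh hpt] at h
  simpa using h

theorem abs_eval_sub_le_linfSub (pt : Fin (N+1) → ℝ) (u : Fin N → Polynomial ℝ) (c : ℝ)
    (j : Fin N) {x : ℝ} (hx : x ∈ Set.Icc (ptL pt j) (ptR pt j)) :
    |(u j).eval x - c| ≤ linfSub pt u c := by
  have h1 : |(u j).eval x - c| ≤
      sSup ((fun x => |(u j).eval x - c|) '' Set.Icc (ptL pt j) (ptR pt j)) := by
    apply le_csSup
    · exact (isCompact_Icc.image (by fun_prop)).bddAbove
    · exact ⟨x, hx, rfl⟩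
  exact h1.trans (le_ciSup (f := fun j : Fin N =>
    sSup ((fun x => |(u j).eval x - c|) '' Set.Icc (ptL pt j) (ptR pt j)))
    (Set.finite_range _).bddAbove j)

theorem periodic_iteratedDeriv {U : ℝ → ℝ} {c : ℝ} (hU : Function.Periodic U c) (m : ℕ) :
    Function.Periodic (iteratedDeriv m U) c := by
  intro x
  have h := congrFun (iteratedDeriv_comp_add_const m U c) x
  rw [← h]
  congr 1
  exact funext hU

/-- A periodic function takes the same value at the two representatives of an interface. -/
theorem periodic_interface [NeZero N] {pt : Fin (N+1) → ℝ} (hpt : IsMesh pt) {f : ℝ → ℝ}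
    (hf : Function.Periodic f 1) (j : Fin N) : f (pt (j+1).castSucc) = f (pt j.succ) := by
  by_cases hj : (j : ℕ) + 1 < N
  · congr 2
    ext
    have h1 : 1 % N = 1 := Nat.mod_eq_of_lt (by omega)
    simp [Fin.val_add, h1, Nat.mod_eq_of_lt hj]
  · have hjN : (j : ℕ) + 1 = N := by have := j.2; omega
    have h0 : (j+1).castSucc = 0 := by
      ext
      simp [Fin.val_add, hjN]
    have h1 : j.succ = Fin.last N := by ext; simpa using hjN
    rw [h0, h1, hpt.1, hpt.2.1]
    simpa using (hf 0).symm

/-- Passage from local bounds involving neighbouring cells to a global `L²` bound. -/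
theorem l2_le_of_cl2_le [NeZero N] {pt : Fin (N+1) → ℝ} (hpt : IsMesh pt) {γ : ℝ} (hγ : 1 ≤ γ)
    (hq : QuasiUniform pt γ) {z ξ : Fin N → Polynomial ℝ} {A e : ℝ} (hA : 0 ≤ A) (he : 0 ≤ e)
    {B : Fin N → ℝ} (hB : ∀ j, B j = cl2 pt j (ξ j) / √(meshSize pt) + e)
    (hz : ∀ j, cl2 pt j (z j) ≤ A * √(meshSize pt) * (B (j-1) + 2 * B j + B (j+1))) :
    l2 pt z ≤ 6 * γ * A * (l2 pt ξ + e) := by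
  set h := meshSize pt with hh
  have hh0 : 0 < h := (cellh_pos hpt 0).trans_le (cellh_le_meshSize pt 0)
  have hB0 : ∀ j, 0 ≤ B j := fun j => by
    rw [hB]; have := cl2_nonneg pt j (ξ j); positivity
  have hξ : l2 pt ξ ^ 2 = ∑ j, cl2 pt j (ξ j) ^ 2 := by
    rw [l2, Real.sq_sqrt]
    · exact Finset.sum_congr rfl fun j _ => (cl2_sq hpt j _).symm
    · exact Finset.sum_nonneg fun j _ => cip_self_nonneg hpt j _
  have hξ0 : 0 ≤ l2 pt ξ := Real.sqrt_nonneg _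
  have hBsq : ∀ j, h * B j ^ 2 ≤ 2 * (cl2 pt j (ξ j) ^ 2 + h * e^2) := by
    intro j
    have h1 : √h * B j = cl2 pt j (ξ j) + √h * e := by
      rw [hB]; field_simp
    calc h * B j ^ 2 = (√h * B j)^2 := by rw [mul_pow, Real.sq_sqrt hh0.le]
      _ = (cl2 pt j (ξ j) + √h * e)^2 := by rw [h1]
      _ ≤ 2 * (cl2 pt j (ξ j) ^ 2 + (√h * e)^2) := add_sq_le
      _ = _ := by rw [mul_pow, Real.sq_sqrt hh0.le]
  have hsum : ∑ j, h * B j ^ 2 ≤ 2 * γ * (l2 pt ξ + e)^2 := by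
    calc ∑ j, h * B j ^ 2 ≤ ∑ j, 2 * (cl2 pt j (ξ j) ^ 2 + h * e^2) :=
          Finset.sum_le_sum fun j _ => hBsq j
      _ = 2 * (l2 pt ξ ^ 2 + N * h * e^2) := by
          rw [← Finset.mul_sum, Finset.sum_add_distrib, ← hξ]; simp; ring
      _ ≤ 2 * (γ * l2 pt ξ ^ 2 + γ * e^2) := by
          have h1 := card_mul_meshSize_le hpt hq
          have h2 : l2 pt ξ ^ 2 ≤ γ * l2 pt ξ ^ 2 := le_mul_of_one_le_left (sq_nonneg _) hγ
          gcongr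
      _ ≤ _ := by nlinarith [mul_nonneg hξ0 he]
  have hshift : ∀ f : Fin N → ℝ, ∑ j, f (j+1) = ∑ j, f j := fun f =>
    Equiv.sum_comp (Equiv.addRight (1 : Fin N)) f
  have hshift' : ∀ f : Fin N → ℝ, ∑ j, f (j-1) = ∑ j, f j := fun f =>
    Equiv.sum_comp (Equiv.subRight (1 : Fin N)) f
  rw [l2]
  apply Real.sqrt_le_iff.2
  refine ⟨by positivity, ?_⟩
  calc ip pt z z = ∑ j, cl2 pt j (z j) ^ 2 :=
        Finset.sum_congr rfl fun j _ => (cl2_sq hpt j _).symm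
    _ ≤ ∑ j, A^2 * (4 * (h * B (j-1)^2 + 2 * (h * B j^2) + h * B (j+1)^2)) := by
        apply Finset.sum_le_sum
        intro j _
        calc cl2 pt j (z j) ^ 2 ≤ (A * √h * (B (j-1) + 2 * B j + B (j+1)))^2 := by
              have := hz j
              have := cl2_nonneg pt j (z j)
              gcongr
          _ = A^2 * (h * (B (j-1) + 2 * B j + B (j+1))^2) := by
              rw [mul_pow, mul_pow, Real.sq_sqrt hh0.le]; ring
          _ ≤ A^2 * (h * (4 * (B (j-1)^2 + 2 * B j^2 + B (j+1)^2))) := by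
              gcongr
              nlinarith [sq_nonneg (B (j-1) - B j), sq_nonneg (B (j+1) - B j),
                sq_nonneg (B (j-1) - B (j+1))]
          _ = _ := by ring
    _ = A^2 * (16 * ∑ j, h * B j^2) := by
        rw [← Finset.mul_sum, ← Finset.mul_sum, Finset.sum_add_distrib, Finset.sum_add_distrib,
          hshift' (fun j => h * B j^2), hshift (fun j => h * B j^2),
          ← Finset.mul_sum univ (fun j => h * B j^2) 2]
        ring
    _ ≤ A^2 * (16 * (2 * γ * (l2 pt ξ + e)^2)) := by gcongr
    _ ≤ A^2 * (36 * γ^2 * (l2 pt ξ + e)^2) := by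
        have : 16 * (2 * γ) ≤ 36 * γ^2 := by nlinarith
        have h2 := mul_le_mul_of_nonneg_right this (sq_nonneg (l2 pt ξ + e))
        have h3 := mul_le_mul_of_nonneg_left h2 (sq_nonneg A)
        linarith
    _ = _ := by ring

/-- On each cell, the derivatives of `u` are close to those of `U`, in the scaling of the mesh. -/
theorem exists_pderiv_sub_iteratedDeriv_le (k : ℕ) {γ M : ℝ} (hγ : 1 ≤ γ) (hM : 0 ≤ M) :
    ∃ c : ℝ, 0 < c ∧ ∀ (N : ℕ) [NeZero N] (pt : Fin (N+1) → ℝ),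
      IsMesh pt → QuasiUniform pt γ →
    ∀ U : ℝ → ℝ, ContDiff ℝ (k+1) U → (∀ x, |iteratedDeriv (k+1) U x| ≤ M) →
    ∀ (i : Fin N) (p q : Polynomial ℝ), p.natDegree ≤ k →
      IsGRProj k (ptL pt i) (ptR pt i) U q → ∀ m ≤ k, ∀ x ∈ Set.Icc (ptL pt i) (ptR pt i),
      meshSize pt ^ m * |(pderiv m p).eval x - iteratedDeriv m U x| ≤
        c * (cl2 pt i (p - q) / √(meshSize pt) + meshSize pt ^ (k+1)) := by
  obtain ⟨c₁, hc₁, hinv⟩ := exists_inverse k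
  obtain ⟨c₂, hc₂, happ⟩ := exists_GRProj_approx k
  have hγ0 : 0 < γ := by linarith
  refine ⟨γ^k * (√(c₁ * γ) + c₂ * M), by positivity, ?_⟩
  intro N _ pt hpt hqu U hU hUM i p q hp hq m hm x hx
  set h := meshSize pt with hh
  set l := cellh pt i with hl
  have hl0 : 0 < l := cellh_pos hpt i
  have hlh : l ≤ h := cellh_le_meshSize pt i
  have hhl : h ≤ γ * l := hqu i
  have hh0 : 0 < h := hl0.trans_le hlh
  have hab := hpt.ptL_lt_ptR i
  have hξd : (p - q).natDegree ≤ k := (natDegree_sub_le _ _).trans (max_le hp hq.1)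
  have h1 : l^m * |(pderiv m (p - q)).eval x| ≤ √(c₁ * γ) * (cl2 pt i (p - q) / √h) := by
    have h2 : (l^m * (pderiv m (p-q)).eval x)^2 * l ≤ c₁ * cl2 pt i (p - q)^2 := by
      rw [cl2_sq hpt]; exact hinv _ _ hab _ hξd m hm x hx
    rw [← abs_of_pos (pow_pos hl0 m), ← abs_mul]
    apply abs_le_of_sq_le_sq _ (by have := cl2_nonneg pt i (p - q); positivity)
    rw [mul_pow (√(c₁ * γ)), div_pow, Real.sq_sqrt (by positivity), Real.sq_sqrt hh0.le,
      ← mul_div_assoc, le_div_iff₀ hh0]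
    calc _ ≤ (l^m * (pderiv m (p-q)).eval x)^2 * (γ * l) := by gcongr
      _ = γ * ((l^m * (pderiv m (p-q)).eval x)^2 * l) := by ring
      _ ≤ γ * (c₁ * cl2 pt i (p - q)^2) := by gcongr
      _ = _ := by ring
  have h3 : l^m * |(pderiv m q).eval x - iteratedDeriv m U x| ≤ c₂ * M * h^(k+1) :=
    (happ M U hU hUM _ _ hab q hq m hm x hx).trans (by
      change c₂ * M * l^(k+1) ≤ _
      gcongr)
  have h4 : |(pderiv m p).eval x - iteratedDeriv m U x| ≤
      |(pderiv m (p - q)).eval x| + |(pderiv m q).eval x - iteratedDeriv m U x| := by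
    rw [pderiv_sub, eval_sub]; exact abs_sub_le _ _ _
  have h5 : h^m ≤ γ^k * l^m := by
    calc h^m ≤ (γ * l)^m := by gcongr
      _ = γ^m * l^m := mul_pow _ _ _
      _ ≤ γ^k * l^m := by gcongr
  calc _ ≤ γ^k * l^m * (|(pderiv m (p - q)).eval x|
        + |(pderiv m q).eval x - iteratedDeriv m U x|) := by gcongr
    _ = γ^k * (l^m * |(pderiv m (p - q)).eval x|
        + l^m * |(pderiv m q).eval x - iteratedDeriv m U x|) := by ring
    _ ≤ γ^k * (√(c₁ * γ) * (cl2 pt i (p - q) / √h) + c₂ * M * h^(k+1)) := by gcongr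
    _ ≤ _ := by
      rw [mul_assoc (γ^k) (√(c₁ * γ) + c₂ * M)]
      have h6 : 0 ≤ cl2 pt i (p - q) / √h := by
        have := cl2_nonneg pt i (p - q); positivity
      have h7 : 0 ≤ h^(k+1) := by positivity
      have h8 : 0 ≤ √(c₁ * γ) := Real.sqrt_nonneg _
      gcongr
      nlinarith [mul_nonneg h8 h7, mul_nonneg (mul_nonneg hc₂.le hM) h6]

theorem dampRate_nonneg [NeZero N] {k : ℕ} (hk : 0 < k) {pt : Fin (N+1) → ℝ} (hpt : IsMesh pt)
    {β : Fin N → ℝ} {j : Fin N} (hβ : 0 ≤ β j) {u : Fin N → Polynomial ℝ}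
    (hu : 0 ≤ linfSub pt u (avg pt u)) (m : ℕ) : 0 ≤ dampRate k pt β u m j := by
  have hc := cellh_pos hpt j
  have hk' : (0:ℝ) < 2 * k - 1 := by
    have : (1:ℝ) ≤ k := by exact_mod_cast hk
    linarith
  have : 0 ≤ sigma k pt u m j := by
    rw [sigma]; split_ifs
    · exact le_rfl
    · positivity
  rw [dampRate]; positivity

/-- A bound on scaled jumps bounds the damping rates. -/
theorem dampRate_le [NeZero N] {k : ℕ} (hk : 0 < k) {pt : Fin (N+1) → ℝ} (hpt : IsMesh pt)
    {γ βmax c0 : ℝ} (hq : QuasiUniform pt γ) (hc0 : 0 < c0)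
    {β : Fin N → ℝ} {j : Fin N} (hβ : 0 ≤ β j ∧ β j ≤ βmax) {u : Fin N → Polynomial ℝ}
    (hu : c0 ≤ linfSub pt u (avg pt u)) {m : ℕ} (hm : m ≤ k) {J : ℝ}
    (hJ : meshSize pt ^ m * (|jumpD pt u m (j-1)| + |jumpD pt u m j|) ≤ J) :
    dampRate k pt β u m j ≤ βmax * ((2*k+1) / (2 * c0)) * γ * J / meshSize pt := by
  have hl := cellh_pos hpt j
  have hlh := cellh_le_meshSize pt j
  have hhl := hq j
  set h := meshSize pt
  set l := cellh pt j with hl_def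
  have hh0 : 0 < h := hl.trans_le hlh
  have hk1 : (1:ℝ) ≤ k := by exact_mod_cast hk
  have hJ0 : 0 ≤ J := le_trans (by positivity) hJ
  have hsig : sigma k pt u m j ≤ (2*k+1) / (2 * c0) * J := by
    rw [sigma]; split_ifs
    · positivity
    · rw [← hl_def]
      set S := |jumpD pt u m (j-1)| + |jumpD pt u m j| with hS
      have hS0 : 0 ≤ S := by positivity
      have hmk : (m:ℝ) ≤ k := by exact_mod_cast hm
      have hfac : (1:ℝ) ≤ Nat.factorial m := by exact_mod_cast Nat.succ_le_of_lt m.factorial_pos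
      have hden : 1 ≤ (2*(k:ℝ)-1) * (Nat.factorial m) := by nlinarith
      have hlin : 0 < linfSub pt u (avg pt u) := hc0.trans_le hu
      have hSlin : 0 ≤ S / (2 * linfSub pt u (avg pt u)) := by positivity
      calc _ ≤ (2*(k:ℝ)+1) * h^m / 1 * (S / (2 * c0)) := by gcongr
        _ = (2*k+1) / (2 * c0) * (h^m * S) := by field_simp
        _ ≤ _ := by gcongr
  have hβ0 : 0 ≤ βmax := hβ.1.trans hβ.2
  have hinv : 1 / l ≤ γ / h := by
    rw [div_le_div_iff₀ hl hh0]; linarith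
  rw [dampRate, ← hl_def]
  calc β j * sigma k pt u m j / l ≤ βmax * ((2*k+1) / (2 * c0) * J) / l := by
        apply div_le_div_of_nonneg_right _ hl.le
        exact (mul_le_mul_of_nonneg_left hsig hβ.1).trans
          (mul_le_mul_of_nonneg_right hβ.2 (by positivity))
    _ = βmax * ((2*k+1) / (2 * c0) * J) * (1 / l) := by ring
    _ ≤ βmax * ((2*k+1) / (2 * c0) * J) * (γ / h) := by gcongr
    _ = _ := by ring

theorem cl2_le_of_abs_eval_le {pt : Fin (N+1) → ℝ} (hpt : IsMesh pt) (j : Fin N)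
    {p : Polynomial ℝ} {B : ℝ} (hB : 0 ≤ B)
    (hp : ∀ x ∈ Set.Icc (ptL pt j) (ptR pt j), |p.eval x| ≤ B) :
    cl2 pt j p ≤ B * √(meshSize pt) := by
  have hl := cellh_pos hpt j
  have hlh := cellh_le_meshSize pt j
  have h1 : cip pt j p p ≤ ∫ _x in (ptL pt j)..(ptR pt j), B^2 := by
    apply intervalIntegral.integral_mono_on (hpt.ptL_lt_ptR j).le
    · exact Continuous.intervalIntegrable (by fun_prop) _ _
    · exact intervalIntegrable_const
    · intro y hy
      rw [← sq, ← sq_abs]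
      have := hp y hy
      gcongr
  rw [intervalIntegral.integral_const, smul_eq_mul] at h1
  apply Real.sqrt_le_iff.2
  refine ⟨by positivity, h1.trans ?_⟩
  rw [mul_pow, Real.sq_sqrt (hl.le.trans hlh), mul_comm]
  exact mul_le_mul_of_nonneg_left hlh (sq_nonneg B)

/-- Lemma 4.8, 1D case, `d = 1`.  Let `u_h ∈ V^k`, `U` a `C^{k+1}`
periodic function with `C^{k+1}` norm bounded by `M`, and `ξ = u_h - P*U`.  Under
quasi-uniformity, `‖u_h - avg(u_h)‖_{L∞} ≥ c₀ > 0`, `0 ≤ β_j ≤ β_max` and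
`‖ξ‖_{L∞(Ω)} ≤ h ≤ 1`, there is `C = C(k, c₀, β_max, γ, M)` such that
`‖F_τ u_h - u_h‖_{L²(Ω)} ≤ C τ (‖ξ‖_{L²(Ω)} + h^{k+1})`. -/
theorem oe_perturbation_estimate
    (k : ℕ) (c0 βmax γ M : ℝ)
    (hc0 : 0 < c0) (hβmax : 0 ≤ βmax) (hγ : 1 ≤ γ) (hM : 0 ≤ M) :
    ∃ C : ℝ, 0 < C ∧
      ∀ (N : ℕ) [NeZero N] (pt : Fin (N+1) → ℝ),
        IsMesh pt → QuasiUniform pt γ →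
      ∀ U : ℝ → ℝ, ContDiff ℝ (k+1) U → Function.Periodic U 1 →
        (∀ m : ℕ, m ≤ k+1 → ∀ x : ℝ, |iteratedDeriv m U x| ≤ M) →
      ∀ uh : Fin N → Polynomial ℝ, MemVk k uh →
      ∀ PU : Fin N → Polynomial ℝ,
        (∀ j, IsGRProj k (ptL pt j) (ptR pt j) U (PU j)) →
      ∀ β : Fin N → ℝ, (∀ j, 0 ≤ β j ∧ β j ≤ βmax) →
      c0 ≤ linfSub pt uh (avg pt uh) →
      linfSub pt (fun i => uh i - PU i) 0 ≤ meshSize pt → meshSize pt ≤ 1 →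
      ∀ τ : ℝ, 0 < τ →
      ∀ Pc : Fin N → ℕ → Polynomial ℝ → Polynomial ℝ, IsCellProj pt Pc →
      ∀ Fτ : (Fin N → Polynomial ℝ) → (Fin N → Polynomial ℝ), IsOEOp k pt β Pc τ Fτ →
        l2 pt (fun j => Fτ uh j - uh j)
          ≤ C * τ * (l2 pt (fun i => uh i - PU i) + meshSize pt ^ (k+1)) := by
  obtain ⟨cE, hcE, hE⟩ := exists_pderiv_sub_iteratedDeriv_le k hγ hM
  obtain ⟨cG, hcG, hG⟩ := exists_GRProj_approx k
  have hγ0 : 0 < γ := by linarith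
  set R : ℝ := βmax * ((2*k+1) / (2 * c0)) * γ * cE with hR
  set D : ℝ := 1 + cG * M + M with hD
  have hR0 : 0 ≤ R := by positivity
  have hD0 : 0 ≤ D := by positivity
  set A : ℝ := k * ((k+1) * R * D) with hA
  have hA0 : 0 ≤ A := by positivity
  refine ⟨6 * γ * A + 1, by positivity, ?_⟩
  intro N _ pt hpt hqu U hU hper hUM uh huh PU hPU β hβ hlin hξ hh1 τ hτ Pc hPc Fτ hF
  obtain ⟨w, hw, hFw⟩ := hF uh huh
  set h := meshSize pt with hh
  have hh0 : 0 < h := (cellh_pos hpt 0).trans_le (cellh_le_meshSize pt 0)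
  have hUtop : ∀ x, |iteratedDeriv (k+1) U x| ≤ M := hUM (k+1) le_rfl
  set B : Fin N → ℝ := fun j => cl2 pt j (uh j - PU j) / √h + h^(k+1) with hB
  have hB0 : ∀ j, 0 ≤ B j := fun j => by
    have := cl2_nonneg pt j (uh j - PU j); positivity
  have hjump : ∀ m ≤ k, ∀ j, h^m * |jumpD pt uh m j| ≤ cE * (B j + B (j+1)) := by
    intro m hm j
    have h1 := hE N pt hpt hqu U hU hUtop (j+1) (uh (j+1)) (PU (j+1)) (huh _) (hPU _) m hm _
      (Set.left_mem_Icc.2 (hpt.ptL_lt_ptR (j+1)).le)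
    have h2 := hE N pt hpt hqu U hU hUtop j (uh j) (PU j) (huh _) (hPU _) m hm _
      (Set.right_mem_Icc.2 (hpt.ptL_lt_ptR j).le)
    have h3 : iteratedDeriv m U (ptL pt (j+1)) = iteratedDeriv m U (ptR pt j) :=
      periodic_interface hpt (periodic_iteratedDeriv hper m) j
    rw [h3] at h1
    have h4 : |jumpD pt uh m j| ≤
        |(pderiv m (uh (j+1))).eval (ptL pt (j+1)) - iteratedDeriv m U (ptR pt j)|
        + |(pderiv m (uh j)).eval (ptR pt j) - iteratedDeriv m U (ptR pt j)| := by
      rw [abs_sub_comm ((pderiv m (uh j)).eval (ptR pt j))]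
      exact abs_sub_le _ _ _
    calc _ ≤ h^m * (|(pderiv m (uh (j+1))).eval (ptL pt (j+1)) - iteratedDeriv m U (ptR pt j)|
        + |(pderiv m (uh j)).eval (ptR pt j) - iteratedDeriv m U (ptR pt j)|) := by gcongr
      _ ≤ cE * B (j+1) + cE * B j := by rw [mul_add]; exact add_le_add h1 h2
      _ = _ := by ring
  have hlin0 : 0 ≤ linfSub pt uh (avg pt uh) := hc0.le.trans hlin
  have hosc : ∀ j, cl2 pt j (uh j - C (U (ptL pt j))) ≤ D * h * √h := by
    intro j
    have hab := hpt.ptL_lt_ptR j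
    have hlh : ptR pt j - ptL pt j ≤ h := cellh_le_meshSize pt j
    apply cl2_le_of_abs_eval_le hpt j (by positivity)
    intro x hx
    have h1 : |(uh j - PU j).eval x| ≤ h := by
      simpa using (abs_eval_sub_le_linfSub pt (fun i => uh i - PU i) 0 j hx).trans hξ
    have h2 : |(PU j).eval x - U x| ≤ cG * M * h := by
      have := hG M U hU hUtop _ _ hab (PU j) (hPU j) 0 (Nat.zero_le _) x hx
      simp only [pow_zero, one_mul, iteratedDeriv_zero] at this
      refine this.trans ?_
      have h3 : (ptR pt j - ptL pt j)^(k+1) ≤ h := by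
        calc _ ≤ h^(k+1) := pow_le_pow_left₀ (sub_pos.2 hab).le hlh _
          _ ≤ h^1 := pow_le_pow_of_le_one hh0.le hh1 (by omega)
          _ = h := pow_one h
      gcongr
    have h4 : |U x - U (ptL pt j)| ≤ M * h := by
      have hdiff : Differentiable ℝ U := hU.differentiable (by simp)
      have := convex_univ.norm_image_sub_le_of_norm_deriv_le (f := U) (C := M)
        (x := ptL pt j) (y := x) (fun y _ => hdiff y)
        (fun y _ => by simpa [iteratedDeriv_one] using hUM 1 (by omega) y) trivial trivial
      refine this.trans ?_
      have : ‖x - ptL pt j‖ ≤ h := by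
        rw [Real.norm_eq_abs, abs_of_nonneg (by linarith [hx.1])]; linarith [hx.2]
      gcongr
    rw [eval_sub] at h1
    rw [eval_sub, eval_C]
    have h5 := abs_sub_le ((uh j).eval x) ((PU j).eval x) (U (ptL pt j))
    have h6 := abs_sub_le ((PU j).eval x) (U x) (U (ptL pt j))
    rw [hD]
    linarith
  have hcell : ∀ j, cl2 pt j (Fτ uh j - uh j) ≤
      A * τ * √h * (B (j-1) + 2 * B j + B (j+1)) := by
    intro j
    rw [hFw]
    set S := B (j-1) + 2 * B j + B (j+1) with hS
    have hS0 : 0 ≤ S := by have := hB0 (j-1); have := hB0 j; have := hB0 (j+1); positivity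
    have hmain := cl2_damping_sub_le hpt hPc huh hw hτ j
      (fun hk m => dampRate_nonneg hk hpt (hβ j).1 hlin0 m) (U (ptL pt j))
    refine hmain.trans ?_
    rcases Nat.eq_zero_or_pos k with hk | hk
    · simp [hA, hk]
    have hrate : ∑ m ∈ range (k+1), dampRate k pt β uh m j ≤ (k+1) * (R * S / h) := by
      have : ∀ m ∈ range (k+1), dampRate k pt β uh m j ≤ R * S / h := by
        intro m hm
        have hmk : m ≤ k := Nat.lt_succ_iff.1 (mem_range.1 hm)
        have h1 := hjump m hmk (j-1)
        have h2 := hjump m hmk j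
        rw [sub_add_cancel] at h1
        have := dampRate_le hk hpt hqu hc0 (hβ j) hlin hmk (J := cE * S) (by
          rw [mul_add]; rw [hS]; linarith)
        refine this.trans (le_of_eq ?_)
        rw [hR]; ring
      have := Finset.sum_le_sum this
      simpa using this
    calc _ ≤ k * (((k+1) * (R * S / h)) * τ * (D * h * √h)) := by
          have := hosc j
          have := cl2_nonneg pt j (uh j - C (U (ptL pt j)))
          gcongr
      _ = _ := by rw [hA]; field_simp
  have hfin := l2_le_of_cl2_le hpt hγ hqu (z := fun j => Fτ uh j - uh j)
    (ξ := fun i => uh i - PU i) (A := A * τ) (e := h^(k+1)) (by positivity) (by positivity)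
    (fun j => rfl) hcell
  refine hfin.trans ?_
  have hl2 : 0 ≤ l2 pt (fun i => uh i - PU i) := Real.sqrt_nonneg _
  have : 6 * γ * (A * τ) ≤ (6 * γ * A + 1) * τ := by nlinarith
  gcongr
end OEDG
end

section
/- (Approximation property of the Gauss–Radau projection.) Let k ≥ 0 be an integer. There is a constant C depending only on k such that for every interval I = [a,b] of length h = b − a and every w ∈ C^{k+1}([a,b]), the Gauss–Radau projection p ∈ ℙ^k of w (the unique polynomial of degree at most k with ∫_I (w − p) q dx = 0 for all q ∈ ℙ^{k−1} and p(b) = w(b)) satisfies ‖w − p‖_{L²(I)} ≤ C h^{k+1} ‖w^{(k+1)}‖_{L²(I)}. -/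
open Polynomial Finset MeasureTheory

namespace OEDG

variable {N : ℕ}

/-- Every real polynomial has a polynomial antiderivative with a prescribed value at a point. -/
lemma exists_antiderivative {k : ℕ} {p : Polynomial ℝ} (hp : p.natDegree ≤ k) (b c : ℝ) :
    ∃ P : Polynomial ℝ, P.natDegree ≤ k + 1 ∧ derivative P = p ∧ P.eval b = c := by
  set Q : Polynomial ℝ := ∑ i ∈ range (k + 1), C (p.coeff i / (i + 1)) * X ^ (i + 1) with hQ
  have hdeg : Q.natDegree ≤ k + 1 := by
    refine natDegree_sum_le_of_forall_le _ _ fun i hi => ?_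
    exact (natDegree_C_mul_X_pow_le _ _).trans (by simpa using hi)
  refine ⟨Q + C (c - Q.eval b), ?_, ?_, by simp⟩
  · exact (natDegree_add_le _ _).trans (by simpa using hdeg)
  · rw [derivative_add, derivative_C, add_zero, hQ, derivative_sum]
    conv_rhs => rw [p.as_sum_range_C_mul_X_pow' (Nat.lt_succ_of_le hp)]
    refine Finset.sum_congr rfl fun i _ => ?_
    have hi : (i : ℝ) + 1 ≠ 0 := by positivity
    rw [derivative_C_mul_X_pow]
    simp [div_mul_cancel₀ _ hi]

/-- Cauchy–Schwarz inequality against the constant function `1` on an interval. -/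
lemma sq_intervalIntegral_le {x b : ℝ} (hxb : x ≤ b) {g : ℝ → ℝ}
    (hg : ContinuousOn g (Set.Icc x b)) :
    (∫ t in x..b, g t) ^ 2 ≤ (b - x) * ∫ t in x..b, g t ^ 2 := by
  rcases hxb.eq_or_lt with rfl | hlt
  · simp
  have hL : 0 < b - x := sub_pos.2 hlt
  have hu : Set.uIcc x b = Set.Icc x b := Set.uIcc_of_le hxb
  have hi1 : IntervalIntegrable g volume x b :=
    ContinuousOn.intervalIntegrable (by rwa [hu])
  have hi2 : IntervalIntegrable (fun t => g t ^ 2) volume x b :=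
    ContinuousOn.intervalIntegrable (by rw [hu]; exact hg.pow 2)
  set G := ∫ t in x..b, g t
  set c := G / (b - x) with hc
  have h0 : 0 ≤ ∫ t in x..b, (g t - c) ^ 2 :=
    intervalIntegral.integral_nonneg hxb fun t _ => sq_nonneg _
  have h1 : ∫ t in x..b, (g t - c) ^ 2
      = (∫ t in x..b, g t ^ 2) - 2 * c * G + (b - x) * c ^ 2 := by
    have : ∀ t, (g t - c) ^ 2 = g t ^ 2 - 2 * c * g t + c ^ 2 := fun t => by ring
    simp_rw [this]
    rw [intervalIntegral.integral_add (hi2.sub (hi1.const_mul _)) (by simp),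
      intervalIntegral.integral_sub hi2 (hi1.const_mul _),
      intervalIntegral.integral_const_mul, intervalIntegral.integral_const, smul_eq_mul]
  have h2 : c * (b - x) = G := div_mul_cancel₀ _ hL.ne'
  nlinarith [mul_nonneg hL.le h0]

/-- A function of class `C^{k+1}` on `[a, b]` is approximated near `b` by a polynomial of degree
at most `k`, with a remainder controlled by the `L²` norm of the derivative of order `k + 1`. -/
lemma exists_polynomial_remainder_le {a b : ℝ} (hab : a < b) (k : ℕ) (f : ℝ → ℝ)
    (hf : ContDiffOn ℝ (k + 1) f (Set.Icc a b)) :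
    ∃ T : Polynomial ℝ, T.natDegree ≤ k ∧ ∀ x ∈ Set.Icc a b,
      |f x - T.eval x| ≤
        √(∫ t in a..b, iteratedDerivWithin (k + 1) f (Set.Icc a b) t ^ 2)
          * (b - x) ^ k * √(b - x) := by
  have hud := uniqueDiffOn_Icc hab
  induction k generalizing f with
  | zero =>
    refine ⟨C (f b), by simp, fun x hx => ?_⟩
    have hxb : Set.Icc x b ⊆ Set.Icc a b := Set.Icc_subset_Icc_left hx.1
    have hcont : ContinuousOn (derivWithin f (Set.Icc a b)) (Set.Icc a b) :=
      hf.continuousOn_derivWithin hud (by simp)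
    have hderiv : ∀ t ∈ Set.Ioo x b,
        HasDerivAt f (derivWithin f (Set.Icc a b) t) t := fun t ht =>
      ((hf.differentiableOn (by simp) t (hxb ⟨ht.1.le, ht.2.le⟩)).hasDerivWithinAt).hasDerivAt
        (Icc_mem_nhds (hx.1.trans_lt ht.1) ht.2)
    have hftc := intervalIntegral.integral_eq_sub_of_hasDerivAt_of_le hx.2
      (hf.continuousOn.mono hxb) hderiv
      (ContinuousOn.intervalIntegrable (by rw [Set.uIcc_of_le hx.2]; exact hcont.mono hxb))
    have hcs := sq_intervalIntegral_le hx.2 (hcont.mono hxb)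
    have hmono : ∫ t in x..b, derivWithin f (Set.Icc a b) t ^ 2
        ≤ ∫ t in a..b, derivWithin f (Set.Icc a b) t ^ 2 :=
      intervalIntegral.integral_mono_interval hx.1 hx.2 le_rfl
        (Filter.Eventually.of_forall fun t => sq_nonneg _)
        (ContinuousOn.intervalIntegrable (by rw [Set.uIcc_of_le hab.le]; exact hcont.pow 2))
    have hbx : 0 ≤ b - x := sub_nonneg.2 hx.2
    simp only [zero_add, pow_zero, mul_one, eval_C, iteratedDerivWithin_one]
    rw [← Real.sqrt_mul' _ hbx]
    apply Real.abs_le_sqrt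
    rw [hftc] at hcs
    nlinarith [mul_le_mul_of_nonneg_left hmono hbx]
  | succ k ih =>
    obtain ⟨S, hS, hbound⟩ := ih (derivWithin f (Set.Icc a b))
      (hf.derivWithin hud (by norm_cast))
    obtain ⟨T, hT, hTS, hTb⟩ := exists_antiderivative hS b (f b)
    refine ⟨T, hT, fun x hx => ?_⟩
    rw [iteratedDerivWithin_succ']
    set M := √(∫ t in a..b,
      iteratedDerivWithin (k + 1) (derivWithin f (Set.Icc a b)) (Set.Icc a b) t ^ 2)
    have hxb : Set.Icc x b ⊆ Set.Icc a b := Set.Icc_subset_Icc_left hx.1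
    have hbx : 0 ≤ b - x := sub_nonneg.2 hx.2
    have hmv := (convex_Icc x b).norm_image_sub_le_of_norm_hasDerivWithin_le
      (f := fun t => f t - T.eval t)
      (f' := fun t => derivWithin f (Set.Icc a b) t - S.eval t)
      (C := M * (b - x) ^ k * √(b - x))
      (fun t ht => by
        refine HasDerivWithinAt.sub ?_ (hTS ▸ T.hasDerivWithinAt t _)
        exact (hf.differentiableOn (by simp) t (hxb ht)).hasDerivWithinAt.mono hxb)
      (fun t ht => by
        refine (hbound t (hxb ht)).trans ?_
        have h1 : b - t ≤ b - x := by linarith [ht.1]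
        have h2 : 0 ≤ b - t := sub_nonneg.2 ht.2
        gcongr)
      (Set.left_mem_Icc.2 hx.2) (Set.right_mem_Icc.2 hx.2)
    simp only [hTb, sub_self, zero_sub, norm_neg, Real.norm_eq_abs, abs_of_nonneg hbx] at hmv
    refine hmv.trans_eq ?_
    ring

/-- Stability of the Gauss–Radau projection onto polynomials of degree at most `k`: if
`R² ≤ A (b - x)^{2k+1}`, and `q` vanishes at `b` with `R - q` orthogonal to all polynomials of
degree less than `k`, then `q` is controlled in `L²`. -/
lemma integral_sq_le_of_orthogonal {a b A : ℝ} (hab : a < b) {k : ℕ} {R : ℝ → ℝ}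
    (hR : ContinuousOn R (Set.Icc a b))
    (hRA : ∀ x ∈ Set.Icc a b, R x ^ 2 ≤ A * (b - x) ^ (2 * k + 1)) (hA : 0 ≤ A)
    {q : Polynomial ℝ} (hq : q.natDegree ≤ k) (hqb : q.eval b = 0)
    (horth : ∀ r : Polynomial ℝ, r.natDegree < k →
      ∫ x in a..b, (R x - q.eval x) * r.eval x = 0) :
    ∫ x in a..b, q.eval x ^ 2 ≤ A * (b - a) ^ (2 * k + 2) := by
  have hh : 0 < b - a := sub_pos.2 hab
  obtain ⟨s, rfl⟩ := dvd_iff_isRoot.2 (show q.IsRoot b from hqb)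
  have integrable_of_cont : ∀ {g : ℝ → ℝ}, ContinuousOn g (Set.Icc a b) →
      IntervalIntegrable g volume a b :=
    fun hg => ContinuousOn.intervalIntegrable (by rwa [Set.uIcc_of_le hab.le])
  have hs : ContinuousOn (fun x => s.eval x) (Set.Icc a b) := s.continuous.continuousOn
  have hiJ : IntervalIntegrable (fun x => (b - x) * s.eval x ^ 2) volume a b :=
    integrable_of_cont (by fun_prop)
  have hiR : IntervalIntegrable (fun x => -(R x * s.eval x)) volume a b :=
    integrable_of_cont (hR.mul hs).neg
  have horth_s : ∫ x in a..b, (R x - ((X - C b) * s).eval x) * s.eval x = 0 := by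
    rcases eq_or_ne s 0 with rfl | hs0
    · simp
    · refine horth s ?_
      rw [natDegree_mul (X_sub_C_ne_zero b) hs0, natDegree_X_sub_C] at hq
      lia
  set J := ∫ x in a..b, (b - x) * s.eval x ^ 2
  have hJ : J = ∫ x in a..b, -(R x * s.eval x) := by
    have h : ∀ x, (R x - ((X - C b) * s).eval x) * s.eval x
        = (b - x) * s.eval x ^ 2 - -(R x * s.eval x) := fun x => by
      simp only [eval_mul, eval_sub, eval_X, eval_C]; ring
    simp_rw [h] at horth_s
    rw [intervalIntegral.integral_sub hiJ hiR] at horth_s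
    exact sub_eq_zero.1 horth_s
  have hpoint : ∀ x ∈ Set.Icc a b,
      -(R x * s.eval x) ≤ 1 / 2 * ((b - x) * s.eval x ^ 2) + 1 / 2 * (A * (b - a) ^ (2 * k)) := by
    intro x hx
    have h2 : (b - x) ^ (2 * k) ≤ (b - a) ^ (2 * k) :=
      pow_le_pow_left₀ (sub_nonneg.2 hx.2) (by linarith [hx.1]) _
    have h3 := mul_le_mul_of_nonneg_left h2 hA
    have h1 := hRA x hx
    rcases hx.2.eq_or_lt with rfl | hlt
    · have hz : R x = 0 := by
        have : R x ^ 2 ≤ 0 := by simpa using h1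
        exact pow_eq_zero_iff two_ne_zero |>.1 (le_antisymm this (sq_nonneg _))
      rw [hz]
      have : 0 ≤ A * (x - a) ^ (2 * k) := by positivity
      linarith
    · have hd : 0 < b - x := sub_pos.2 hlt
      have h4 : 0 ≤ (R x + (b - x) * s.eval x) ^ 2 := sq_nonneg _
      have h5 : (b - x) * (-(R x * s.eval x)) ≤
          (b - x) * (1 / 2 * ((b - x) * s.eval x ^ 2) + 1 / 2 * (A * (b - x) ^ (2 * k))) := by
        rw [pow_succ (b - x)] at h1
        nlinarith
      linarith [le_of_mul_le_mul_left h5 hd]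
  have hJle : J ≤ A * (b - a) ^ (2 * k) * (b - a) := by
    have h := intervalIntegral.integral_mono_on hab.le hiR
      ((hiJ.const_mul _).add (by simp)) hpoint
    rw [← hJ, intervalIntegral.integral_add (hiJ.const_mul _) (by simp),
      intervalIntegral.integral_const_mul, intervalIntegral.integral_const, smul_eq_mul] at h
    change J ≤ 1 / 2 * J + _ at h
    linarith
  have hle : ∫ x in a..b, ((X - C b) * s).eval x ^ 2 ≤ (b - a) * J := by
    rw [← intervalIntegral.integral_const_mul]
    refine intervalIntegral.integral_mono_on hab.le
      (integrable_of_cont (((X - C b) * s).continuous.continuousOn.pow 2))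
      (hiJ.const_mul _) fun x hx => ?_
    simp only [eval_mul, eval_sub, eval_X, eval_C]
    have h1 : 0 ≤ b - x := sub_nonneg.2 hx.2
    have h2 : 0 ≤ x - a := sub_nonneg.2 hx.1
    nlinarith [mul_nonneg (mul_nonneg h2 h1) (sq_nonneg (s.eval x))]
  calc _ ≤ (b - a) * J := hle
    _ ≤ (b - a) * (A * (b - a) ^ (2 * k) * (b - a)) := by gcongr
    _ = _ := by ring

/-- Approximation property of the Gauss–Radau projection.  There is
`C = C(k)` such that for every interval `[a,b]` of length `h = b - a` and every
`w ∈ C^{k+1}([a,b])`, the Gauss–Radau projection `p ∈ ℙ^k` of `w` satisfies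
`‖w - p‖_{L²(I)} ≤ C h^{k+1} ‖w^{(k+1)}‖_{L²(I)}`. -/
theorem gaussRadau_approximation (k : ℕ) :
    ∃ C : ℝ, 0 < C ∧
      ∀ a b : ℝ, a < b →
      ∀ w : ℝ → ℝ, ContDiffOn ℝ (k+1) w (Set.Icc a b) →
      ∀ p : Polynomial ℝ, p.natDegree ≤ k →
        (∀ q : Polynomial ℝ, q.natDegree < k →
          (∫ x in a..b, (w x - p.eval x) * q.eval x) = 0) →
        p.eval b = w b →
        Real.sqrt (∫ x in a..b, (w x - p.eval x)^2)
          ≤ C * (b - a)^(k+1)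
            * Real.sqrt (∫ x in a..b, (iteratedDerivWithin (k+1) w (Set.Icc a b) x)^2) := by
  refine ⟨2, two_pos, fun a b hab w hw p hp horth hpb => ?_⟩
  obtain ⟨T, hT, hbound⟩ := exists_polynomial_remainder_le hab k w hw
  set I := ∫ t in a..b, iteratedDerivWithin (k + 1) w (Set.Icc a b) t ^ 2
  have hI : 0 ≤ I := intervalIntegral.integral_nonneg hab.le fun t _ => sq_nonneg _
  have hh : 0 < b - a := sub_pos.2 hab
  have integrable_of_cont : ∀ {g : ℝ → ℝ}, ContinuousOn g (Set.Icc a b) →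
      IntervalIntegrable g volume a b :=
    fun hg => ContinuousOn.intervalIntegrable (by rwa [Set.uIcc_of_le hab.le])
  have hR : ContinuousOn (fun x => w x - T.eval x) (Set.Icc a b) :=
    hw.continuousOn.sub T.continuous.continuousOn
  have hRI : ∀ x ∈ Set.Icc a b, (w x - T.eval x) ^ 2 ≤ I * (b - x) ^ (2 * k + 1) := by
    intro x hx
    have h := pow_le_pow_left₀ (abs_nonneg _) (hbound x hx) 2
    rw [sq_abs, mul_pow, mul_pow, Real.sq_sqrt hI, Real.sq_sqrt (sub_nonneg.2 hx.2)] at h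
    refine h.trans_eq ?_
    ring
  have hTb : T.eval b = w b := by
    have h : (w b - T.eval b) ^ 2 ≤ 0 := by simpa using hRI b (Set.right_mem_Icc.2 hab.le)
    exact (sub_eq_zero.1 ((pow_eq_zero_iff two_ne_zero).1 (le_antisymm h (sq_nonneg _)))).symm
  have hq : ∫ x in a..b, (p - T).eval x ^ 2 ≤ I * (b - a) ^ (2 * k + 2) := by
    refine integral_sq_le_of_orthogonal hab hR hRI hI
      ((natDegree_sub_le _ _).trans (max_le hp hT)) (by simp [hpb, hTb]) fun r hr => ?_
    rw [← horth r hr]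
    congr 1 with x
    simp
  have hRint : ∫ x in a..b, (w x - T.eval x) ^ 2 ≤ I * (b - a) ^ (2 * k + 2) := by
    have h := intervalIntegral.integral_mono_on hab.le (integrable_of_cont (hR.pow 2))
      (integrable_of_cont (continuousOn_const (c := I * (b - a) ^ (2 * k + 1)))) fun x hx =>
        (hRI x hx).trans (mul_le_mul_of_nonneg_left
          (pow_le_pow_left₀ (sub_nonneg.2 hx.2) (by linarith [hx.1]) _) hI)
    rw [intervalIntegral.integral_const, smul_eq_mul] at h
    refine h.trans_eq ?_
    ring
  have hiR : IntervalIntegrable (fun x => (w x - T.eval x) ^ 2) volume a b :=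
    integrable_of_cont (hR.pow 2)
  have hiq : IntervalIntegrable (fun x => (p - T).eval x ^ 2) volume a b :=
    integrable_of_cont ((p - T).continuous.continuousOn.pow 2)
  have htotal : ∫ x in a..b, (w x - p.eval x) ^ 2
      ≤ 2 * (∫ x in a..b, (w x - T.eval x) ^ 2) + 2 * ∫ x in a..b, (p - T).eval x ^ 2 := by
    rw [← intervalIntegral.integral_const_mul, ← intervalIntegral.integral_const_mul,
      ← intervalIntegral.integral_add (hiR.const_mul _) (hiq.const_mul _)]
    refine intervalIntegral.integral_mono_on hab.le
      (integrable_of_cont ((hw.continuousOn.sub p.continuous.continuousOn).pow 2))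
      ((hiR.const_mul _).add (hiq.const_mul _)) fun x _ => ?_
    rw [eval_sub]
    nlinarith [sq_nonneg (w x - T.eval x + (p.eval x - T.eval x))]
  refine (Real.sqrt_le_sqrt (show _ ≤ (2 * (b - a) ^ (k + 1)) ^ 2 * I from ?_)).trans_eq ?_
  · calc _ ≤ 4 * (I * (b - a) ^ (2 * k + 2)) := by linarith
      _ = _ := by ring
  · rw [Real.sqrt_mul (sq_nonneg _), Real.sqrt_sq (by positivity)]
end OEDG
end

section
/- (Superconvergence of the Gauss–Radau projection with respect to the upwind DG bilinear form.) Let w be a piecewise-C^{k+1} function on Ω (smooth on the closure of each cell), and set η = w − P*w. Then H(η, v) = 0 for every v ∈ V^k; that is, β Σ_j ∫_{I_j} η v_x dx + β Σ_j η(x_{j+1/2}^−)[v]_{j+1/2} = 0 for all v ∈ V^k. -/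
open Polynomial Finset MeasureTheory

namespace OEDG

variable {N : ℕ}

/-- On a single cell, the Gauss–Radau error is orthogonal to the derivative of every
polynomial of degree at most `k`. -/
theorem IsGRProj.integral_mul_derivative_eq_zero {k : ℕ} {a b : ℝ} {w : ℝ → ℝ}
    {p : Polynomial ℝ} (hp : IsGRProj k a b w p) {v : Polynomial ℝ} (hv : v.natDegree ≤ k) :
    (∫ x in a..b, (w x - p.eval x) * (Polynomial.derivative v).eval x) = 0 := by
  rcases Nat.eq_zero_or_pos v.natDegree with h | h
  · simp [Polynomial.derivative_of_natDegree_zero h]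
  · exact hp.2.1 _ ((Polynomial.natDegree_derivative_lt h.ne').trans_le hv)

/-- Superconvergence of the Gauss–Radau projection with respect to the
upwind DG bilinear form.  Let `w` be piecewise `C^{k+1}` on `Ω` (given by cell
functions `wc j`, smooth on the closure of each cell) and `η = w - P*w`.  Then
`H(η, v) = β ∑_j ∫_{I_j} η v_x dx + β ∑_j η(x_{j+1/2}^-) [v]_{j+1/2} = 0`
for every `v ∈ V^k`. -/
theorem gaussRadau_superconvergence
    {N : ℕ} [NeZero N] (k : ℕ) (pt : Fin (N+1) → ℝ) (hpt : IsMesh pt)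
    (β : ℝ) (hβ : 0 < β)
    (wc : Fin N → ℝ → ℝ)
    (hwc : ∀ j, ContDiffOn ℝ (k+1) (wc j) (Set.Icc (ptL pt j) (ptR pt j)))
    (P : Fin N → Polynomial ℝ)
    (hP : ∀ j, IsGRProj k (ptL pt j) (ptR pt j) (wc j) (P j)) :
    ∀ v : Fin N → Polynomial ℝ, MemVk k v →
      β * ∑ j : Fin N, (∫ x in (ptL pt j)..(ptR pt j),
          (wc j x - (P j).eval x) * (Polynomial.derivative (v j)).eval x)
      + β * ∑ j : Fin N, (wc j (ptR pt j) - (P j).eval (ptR pt j)) * jumpD pt v 0 j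
      = 0 := by
  intro v hv
  have hint j := (hP j).integral_mul_derivative_eq_zero (hv j)
  have hend j : wc j (ptR pt j) - (P j).eval (ptR pt j) = 0 := sub_eq_zero.2 (hP j).2.2.symm
  simp [hint, hend]

end OEDG
end

section
/- (Abstract estimates for the linear damping flow in a Hilbert space.) Let H be a real Hilbert space, let W_0, …, W_k be closed (complete) subspaces of H with orthogonal projections Q_0, …, Q_k, let δ_0, …, δ_k ≥ 0 be real numbers, and let u₀ ∈ H. Let u : [0,∞) → H be the unique solution of the linear ODE u′(t) = −Σ_{m=0}^k δ_m (u(t) − Q_m u(t)) with u(0) = u₀. Then for every τ ≥ 0: (i) ‖u(τ)‖ ≤ ‖u₀‖ (and more generally t ↦ ‖u(t)‖ is nonincreasing); and (ii) ‖u(τ) − u₀‖ ≤ τ Σ_{m=0}^k δ_m ‖u₀ − Q_m u₀‖. -/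
open Polynomial Finset MeasureTheory

namespace OEDG

variable {N : ℕ}

open scoped RealInnerProductSpace in
/-- Solutions of `u' = -A u` on `[0,∞)` have nonincreasing norm when `⟪A x, x⟫ ≥ 0`. -/
theorem antitoneOn_norm_of_hasDerivAt_neg {H : Type*} [NormedAddCommGroup H]
    [InnerProductSpace ℝ H] {A : H → H} (hA : ∀ x, 0 ≤ ⟪A x, x⟫) {u : ℝ → H}
    (hu : ∀ t, 0 ≤ t → HasDerivAt u (-A (u t)) t) :
    AntitoneOn (fun t => ‖u t‖) (Set.Ici 0) := by
  have hsq : AntitoneOn (fun t => ‖u t‖ ^ 2) (Set.Ici 0) := by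
    refine antitoneOn_of_hasDerivWithinAt_nonpos (f' := fun t => 2 * ⟪u t, -A (u t)⟫)
      (convex_Ici 0)
      (fun t ht => (hu t ht).norm_sq.continuousAt.continuousWithinAt) ?_ ?_
    · intro t ht
      exact (hu t (interior_subset ht)).norm_sq.hasDerivWithinAt
    · intro t _
      have := hA (u t)
      rw [inner_neg_right, real_inner_comm]
      linarith
  intro s hs t ht hst
  exact (sq_le_sq₀ (norm_nonneg _) (norm_nonneg _)).1 (hsq hs ht hst)

open scoped RealInnerProductSpace in
/-- Solutions of `u' = -A u` on `[0,∞)` with `A` bounded linear and `⟪A x, x⟫ ≥ 0` move with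
speed at most the initial one. -/
theorem norm_sub_le_of_hasDerivAt_neg {H : Type*} [NormedAddCommGroup H]
    [InnerProductSpace ℝ H] (A : H →L[ℝ] H) (hA : ∀ x, 0 ≤ ⟪A x, x⟫) {u : ℝ → H}
    (hu : ∀ t, 0 ≤ t → HasDerivAt u (-A (u t)) t) {τ : ℝ} (hτ : 0 ≤ τ) :
    ‖u τ - u 0‖ ≤ τ * ‖A (u 0)‖ := by
  have hspeed : AntitoneOn (fun t => ‖A (u t)‖) (Set.Ici 0) :=
    antitoneOn_norm_of_hasDerivAt_neg (u := fun t => A (u t)) hA fun t ht => by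
      simpa [Function.comp_def] using A.hasFDerivAt.comp_hasDerivAt t (hu t ht)
  have h := norm_image_sub_le_of_norm_deriv_le_segment' (f := u) (a := 0) (b := τ)
    (C := ‖A (u 0)‖) (fun t ht => (hu t ht.1).hasDerivWithinAt)
    (fun t ht => by
      rw [norm_neg]
      exact hspeed Set.self_mem_Ici ht.1 ht.1) τ (Set.right_mem_Icc.2 hτ)
  simpa [mul_comm] using h

open scoped RealInnerProductSpace in
/-- Abstract estimates for the linear damping flow in a Hilbert
space.  Let `W_0, …, W_k` be closed subspaces of a real Hilbert space `H` with
orthogonal projections `Q_0, …, Q_k`, let `δ_m ≥ 0`, and let `u` solve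
`u' = -∑_m δ_m (u - Q_m u)` on `[0,∞)` with `u(0) = u₀`.  Then `t ↦ ‖u(t)‖` is
nonincreasing on `[0,∞)` (in particular `‖u(τ)‖ ≤ ‖u₀‖`), and
`‖u(τ) - u₀‖ ≤ τ ∑_m δ_m ‖u₀ - Q_m u₀‖` for every `τ ≥ 0`. -/
theorem abstract_damping_flow
    (H : Type*) [NormedAddCommGroup H] [InnerProductSpace ℝ H] [CompleteSpace H]
    (k : ℕ) (W : Fin (k+1) → Submodule ℝ H) (hWclosed : ∀ i, IsClosed (W i : Set H))
    (Q : Fin (k+1) → H →ₗ[ℝ] H)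
    (hQmem : ∀ i x, Q i x ∈ W i)
    (hQorth : ∀ (i : Fin (k+1)) (x : H), ∀ y ∈ W i, ⟪x - Q i x, y⟫ = (0:ℝ))
    (δ : Fin (k+1) → ℝ) (hδ : ∀ i, 0 ≤ δ i)
    (u₀ : H) (uu : ℝ → H) (hu0 : uu 0 = u₀)
    (hode : ∀ t : ℝ, 0 ≤ t →
      HasDerivAt uu (-(∑ i : Fin (k+1), δ i • (uu t - Q i (uu t)))) t) :
    AntitoneOn (fun t => ‖uu t‖) (Set.Ici 0) ∧
    (∀ τ : ℝ, 0 ≤ τ → ‖uu τ‖ ≤ ‖u₀‖) ∧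
    (∀ τ : ℝ, 0 ≤ τ → ‖uu τ - u₀‖ ≤ τ * ∑ i : Fin (k+1), δ i * ‖u₀ - Q i u₀‖) := by
  have hinner (i : Fin (k+1)) (x : H) : ⟪x - Q i x, x⟫ = ‖x - Q i x‖ ^ 2 := by
    have h := hQorth i x _ (hQmem i x)
    rw [← real_inner_self_eq_norm_sq, inner_sub_right (x - Q i x), h, sub_zero]
  have hbound (i : Fin (k+1)) (x : H) : ‖x - Q i x‖ ≤ 1 * ‖x‖ := by
    have h := real_inner_le_norm (x - Q i x) x
    rw [hinner] at h
    nlinarith [norm_nonneg (x - Q i x), norm_nonneg x]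
  let A : H →L[ℝ] H :=
    ∑ i, δ i • (LinearMap.id - Q i).mkContinuous 1 fun x => by simpa using hbound i x
  have hAapply (x : H) : A x = ∑ i, δ i • (x - Q i x) := by
    simp [A]
  have hA (x : H) : 0 ≤ ⟪A x, x⟫ := by
    rw [hAapply, sum_inner]
    refine Finset.sum_nonneg fun i _ => ?_
    rw [real_inner_smul_left, hinner]
    exact mul_nonneg (hδ i) (sq_nonneg _)
  have hu (t : ℝ) (ht : 0 ≤ t) : HasDerivAt uu (-A (uu t)) t := by
    rw [hAapply]
    exact hode t ht
  have hanti := antitoneOn_norm_of_hasDerivAt_neg hA hu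
  subst hu0
  refine ⟨hanti, fun τ hτ => hanti Set.self_mem_Ici hτ hτ, fun τ hτ => ?_⟩
  refine (norm_sub_le_of_hasDerivAt_neg A hA hu hτ).trans
    (mul_le_mul_of_nonneg_left ?_ hτ)
  rw [hAapply]
  refine (norm_sum_le _ _).trans_eq (Finset.sum_congr rfl fun i _ => ?_)
  rw [norm_smul, Real.norm_of_nonneg (hδ i)]

end OEDG
end
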